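/- Let n ≥ 2 be an integer and let f : ℝⁿ → ℝ be continuous and Lebesgue integrable with α := ∫_{ℝⁿ} max(f,0) dx < c_n and β := ∫_{ℝⁿ} max(−f,0) dx < ∞, such that y ↦ log(|y|/|x−y|) f(y) is Lebesgue integrable for every x ∈ ℝⁿ. Let C₀ ∈ ℝ and set u(x) := (1/c_n) ∫_{ℝⁿ} log(|y|/|x−y|) f(y) dy + C₀. Then there is a constant C depending only on n, α, β such that for every compactly supported C¹ function h : ℝⁿ → ℝ, (∫_{ℝⁿ} |h(x)|^{n/(n−1)} e^{n u(x)} dx)^{(n−1)/n} ≤ C ∫_{ℝⁿ} ‖∇h(x)‖ e^{(n−1) u(x)} dx. (This is the isoperimetric inequality for the conformal metric g = e^{2u}|dx|², in its equivalent p = 1 Sobolev form; in the paper f = (2/c_n)·(c_n/2)·Q_g e^{nu} is the Q-curvature density of a normal metric.) -/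

import Mathlib

open MeasureTheory Metric Set
open scoped ENNReal

/-- `c_n := 2^{n-2} Γ(n/2) π^{n/2}`. -/
noncomputable def cN (n : ℕ) : ℝ :=
  (2 : ℝ) ^ ((n : ℝ) - 2) * Real.Gamma ((n : ℝ) / 2) * Real.pi ^ ((n : ℝ) / 2)

/-- Logarithmic potential `u(x) = (1/c_n) ∫ log(|y|/|x-y|) f(y) dy`. -/
noncomputable def logPot (n : ℕ) (f : EuclideanSpace ℝ (Fin n) → ℝ)
    (x : EuclideanSpace ℝ (Fin n)) : ℝ :=
  (1 / cN n) * ∫ y, Real.log (‖y‖ / ‖x - y‖) * f y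

/-- `ω` is an `A_p` weight with constant `K` (for `p > 1`):
for every ball `B`, `(⨍_B ω) · (⨍_B ω^{-1/(p-1)})^{p-1} ≤ K`. -/
def IsApWeight (n : ℕ) (p K : ℝ) (ω : EuclideanSpace ℝ (Fin n) → ℝ) : Prop :=
  ∀ (x : EuclideanSpace ℝ (Fin n)) (r : ℝ), 0 < r →
    ((volume (ball x r)).toReal⁻¹ * ∫ y in ball x r, ω y) *
      ((volume (ball x r)).toReal⁻¹ *
        ∫ y in ball x r, (ω y) ^ (-(1 / (p - 1)) : ℝ)) ^ (p - 1) ≤ K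

/-- `δ_ω(x,y) = (∫_{B_{xy}} ω)^{1/n}`, where `B_{xy}` is the closed ball with
center `(x+y)/2` and radius `|x-y|/2`. -/
noncomputable def deltaW (n : ℕ) (ω : EuclideanSpace ℝ (Fin n) → ℝ)
    (x y : EuclideanSpace ℝ (Fin n)) : ℝ :=
  (∫ z in closedBall (midpoint ℝ x y) (dist x y / 2), ω z) ^ ((1 : ℝ) / n)

/-- `d_ω(x,y)`: infimum of `∫₀^L ω(γ(t))^{1/n} dt` over all `L ≥ 0` and all
1-Lipschitz curves `γ : [0,L] → ℝⁿ` joining `x` to `y` inside `B_{xy}`. -/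
noncomputable def dW (n : ℕ) (ω : EuclideanSpace ℝ (Fin n) → ℝ)
    (x y : EuclideanSpace ℝ (Fin n)) : ℝ :=
  sInf {d : ℝ | ∃ (L : ℝ) (γ : ℝ → EuclideanSpace ℝ (Fin n)),
    0 ≤ L ∧ LipschitzOnWith 1 γ (Set.Icc 0 L) ∧ γ 0 = x ∧ γ L = y ∧
    (∀ t ∈ Set.Icc 0 L, γ t ∈ closedBall (midpoint ℝ x y) (dist x y / 2)) ∧
    d = ∫ t in (0 : ℝ)..L, (ω (γ t)) ^ ((1 : ℝ) / n)}

/-- One-dimensional Hausdorff content: infimum of `Σᵢ diam Bᵢ` over countable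
covers of `E` by balls `Bᵢ`. -/
noncomputable def H1content {n : ℕ} (E : Set (EuclideanSpace ℝ (Fin n))) : ℝ≥0∞ :=
  ⨅ (c : ℕ → EuclideanSpace ℝ (Fin n) × ℝ) (_ : E ⊆ ⋃ i, ball (c i).1 (c i).2),
    ∑' i, ENNReal.ofReal (2 * (c i).2)

open scoped ENNReal

abbrev EE (n : ℕ) := EuclideanSpace ℝ (Fin n)

lemma lint_affine {n : ℕ} (Φ : EE n → ℝ≥0∞) (hΦ : Measurable Φ) (s : ℝ) (hs : 0 < s) (c : EE n) :
    ∫⁻ x, Φ (s • x + c) = ENNReal.ofReal ((s ^ n)⁻¹) * ∫⁻ x, Φ x := by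
  have h1 : ∫⁻ x, Φ (s • x + c) = ∫⁻ x, (fun z => Φ (z + c)) x ∂(Measure.map (s • ·) volume) := by
    rw [lintegral_map (by fun_prop) (by fun_prop)]
  rw [h1, Measure.map_addHaar_smul _ hs.ne', lintegral_smul_measure, lintegral_add_right_eq_self]
  simp only [finrank_euclideanSpace, Fintype.card_fin, smul_eq_mul]
  rw [abs_of_pos (by positivity)]

lemma vol_ball {n : ℕ} (x : EE n) {r : ℝ} (hr : 0 < r) :
    volume (ball x r) = ENNReal.ofReal (r ^ n) * volume (ball (0 : EE n) 1) := by
  rw [Measure.addHaar_ball_of_pos _ x hr]; simp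

lemma kernel_bound (n : ℕ) (hn : 2 ≤ n) (p : ℝ) (hp0 : 0 ≤ p) (hp : p < n) :
    ∃ K : ℝ, 0 < K ∧ ∀ (x₀ y : EE n) (R : ℝ), 0 < R →
      ∫⁻ z in ball x₀ R, ENNReal.ofReal ((R / ‖z - y‖) ^ p) ≤ ENNReal.ofReal (K * R ^ n) := by
  have hint : IntegrableOn (fun z : EE n => (1 / ‖z‖) ^ p) (ball 0 1) := by
    apply integrableOn_ball_of_norm_le_rpow (C := 1) (α := p)
    · simpa using hp
    · refine Filter.Eventually.of_forall fun z => ?_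
      rw [Real.norm_of_nonneg (by positivity), one_mul, one_div, Real.inv_rpow (norm_nonneg _),
        Real.rpow_neg (norm_nonneg _)]
    · exact (by fun_prop : Measurable (fun z : EE n => (1 / ‖z‖) ^ p)).aestronglyMeasurable
    · simp; omega
  set J : ℝ := ∫ z in ball (0 : EE n) 1, (1 / ‖z‖) ^ p with hJ
  have hJ0 : 0 ≤ J := integral_nonneg fun z => by positivity
  have hJ' : ∫⁻ z in ball (0 : EE n) 1, ENNReal.ofReal ((1 / ‖z‖) ^ p) = ENNReal.ofReal J := by
    rw [hJ, ofReal_integral_eq_lintegral_ofReal hint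
      (Filter.Eventually.of_forall fun z => by positivity)]
  set V : ℝ := (volume (ball (0 : EE n) 1)).toReal with hV
  have hV' : volume (ball (0 : EE n) 1) = ENNReal.ofReal V := by
    rw [hV, ENNReal.ofReal_toReal measure_ball_lt_top.ne]
  have hV0 : 0 < V := ENNReal.toReal_pos (measure_ball_pos _ _ one_pos).ne' measure_ball_lt_top.ne
  refine ⟨V + J, by positivity, fun x₀ y R hR => ?_⟩
  have hpt : ∀ z, ENNReal.ofReal ((R / ‖z - y‖) ^ p) ≤
      1 + (ball (0 : EE n) 1).indicator (fun z => ENNReal.ofReal ((1 / ‖z‖) ^ p))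
        (R⁻¹ • z + (-(R⁻¹ • y))) := by
    intro z
    have e : R⁻¹ • z + (-(R⁻¹ • y)) = R⁻¹ • (z - y) := by rw [smul_sub]; abel
    have e2 : ‖R⁻¹ • (z - y)‖ = ‖z - y‖ / R := by
      rw [norm_smul, Real.norm_of_nonneg (by positivity)]; ring
    rw [e]
    by_cases hz : ‖z - y‖ < R
    · rw [indicator_of_mem]
      · rw [e2, one_div_div]; exact le_add_self
      · rw [mem_ball_zero_iff, e2, div_lt_one hR]; exact hz
    · refine le_trans ?_ le_self_add
      rw [← ENNReal.ofReal_one]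
      apply ENNReal.ofReal_le_ofReal
      apply Real.rpow_le_one (by positivity) _ hp0
      push Not at hz
      exact div_le_one_of_le₀ hz (norm_nonneg _)
  have hm : Measurable ((ball (0 : EE n) 1).indicator
      (fun z : EE n => ENNReal.ofReal ((1 / ‖z‖) ^ p))) :=
    Measurable.indicator (by fun_prop) measurableSet_ball
  calc ∫⁻ z in ball x₀ R, ENNReal.ofReal ((R / ‖z - y‖) ^ p) 
      ≤ ∫⁻ z in ball x₀ R, (1 + (ball (0 : EE n) 1).indicator
          (fun z => ENNReal.ofReal ((1 / ‖z‖) ^ p)) (R⁻¹ • z + (-(R⁻¹ • y)))) :=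
        lintegral_mono hpt
    _ = volume (ball x₀ R) + ∫⁻ z in ball x₀ R, (ball (0 : EE n) 1).indicator
          (fun z => ENNReal.ofReal ((1 / ‖z‖) ^ p)) (R⁻¹ • z + (-(R⁻¹ • y))) := by
        rw [lintegral_add_left measurable_const]; simp
    _ ≤ volume (ball x₀ R) + ∫⁻ z, (ball (0 : EE n) 1).indicator
          (fun z => ENNReal.ofReal ((1 / ‖z‖) ^ p)) (R⁻¹ • z + (-(R⁻¹ • y))) := by
        gcongr; exact Measure.restrict_le_self
    _ = ENNReal.ofReal ((V + J) * R ^ n) := by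
        rw [lint_affine _ hm _ (by positivity), lintegral_indicator measurableSet_ball, hJ',
          vol_ball _ hR, hV', ← ENNReal.ofReal_mul (by positivity),
          ← ENNReal.ofReal_mul (by positivity), ← ENNReal.ofReal_add (by positivity) (by positivity)]
        congr 1
        simp; ring

/-- the segment -/
def seg {n : ℕ} (x y : EE n) (s : ℝ) : EE n := x + s • (y - x)

lemma seg_meas {n : ℕ} : Measurable (fun q : (EE n × EE n) × ℝ => seg q.1.1 q.1.2 q.2) := by
  unfold seg; fun_prop

lemma seg_mem {n : ℕ} {x₀ x y : EE n} {r s : ℝ} (hx : x ∈ ball x₀ r) (hy : y ∈ ball x₀ r)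
    (hs : s ∈ Icc (0:ℝ) 1) : seg x y s ∈ ball x₀ r := by
  unfold seg
  exact (convex_ball x₀ r).add_smul_sub_mem hx hy hs

lemma seg_bound_aux {n : ℕ} (x₀ : EE n) (r : ℝ) (Φ : EE n → ℝ≥0∞) (hΦ : Measurable Φ)
    (y : EE n) (hy : y ∈ ball x₀ r) (s : ℝ) (hs : s ∈ Icc (0:ℝ) (1/2)) :
    ∫⁻ x in ball x₀ r, Φ (seg x y s) ≤ 2 ^ n * ∫⁻ z in ball x₀ r, Φ z := by
  have hs1 : 0 < 1 - s := by linarith [hs.2]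
  calc ∫⁻ x in ball x₀ r, Φ (seg x y s) 
      = ∫⁻ x in ball x₀ r, (ball x₀ r).indicator Φ ((1 - s) • x + s • y) := by
        apply setLIntegral_congr_fun measurableSet_ball
        intro x hx
        have e : (1 - s) • x + s • y = seg x y s := by
          unfold seg; rw [smul_sub, sub_smul, one_smul]; abel
        simp only
        rw [e, indicator_of_mem (seg_mem hx hy ⟨hs.1, by linarith [hs.2]⟩)]
    _ ≤ ∫⁻ x, (ball x₀ r).indicator Φ ((1 - s) • x + s • y) := by
        apply lintegral_mono' Measure.restrict_le_self le_rfl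
    _ = ENNReal.ofReal (((1 - s) ^ n)⁻¹) * ∫⁻ z in ball x₀ r, Φ z := by
        rw [lint_affine _ (hΦ.indicator measurableSet_ball) _ hs1,
          lintegral_indicator measurableSet_ball]
    _ ≤ _ := by
        gcongr
        have : ((1 - s) ^ n)⁻¹ ≤ 2 ^ n := by
          rw [← inv_pow]
          apply pow_le_pow_left₀ (by positivity)
          rw [inv_le_comm₀ hs1 (by norm_num)]; linarith [hs.2]
        calc _ ≤ ENNReal.ofReal (2 ^ n) := ENNReal.ofReal_le_ofReal this
          _ = _ := by rw [ENNReal.ofReal_pow (by norm_num)]; simp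

lemma seg_bound {n : ℕ} (x₀ : EE n) (r : ℝ) (Φ : EE n → ℝ≥0∞) (hΦ : Measurable Φ) :
    ∫⁻ q, (∫⁻ s in Icc (0:ℝ) 1, Φ (seg q.1 q.2 s))
      ∂((volume.restrict (ball x₀ r)).prod (volume.restrict (ball x₀ r))) ≤
      2 ^ n * volume (ball x₀ r) * ∫⁻ z in ball x₀ r, Φ z := by
  set μ := volume.restrict (ball x₀ r) with hμ
  have hjm : Measurable (fun q : (EE n × EE n) × ℝ => Φ (seg q.1.1 q.1.2 q.2)) := hΦ.comp seg_meas
  rw [lintegral_lintegral_swap (by exact hjm.aemeasurable)]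
  have key : ∀ s ∈ Icc (0:ℝ) 1, ∫⁻ q, Φ (seg q.1 q.2 s) ∂(μ.prod μ) ≤
      2 ^ n * volume (ball x₀ r) * ∫⁻ z in ball x₀ r, Φ z := by
    intro s hs
    have hjs : Measurable (fun q : (EE n × EE n) => Φ (seg q.1 q.2 s)) :=
      hjm.comp (by fun_prop : Measurable (fun q : EE n × EE n => (q, s)))
    have hconst : ∫⁻ y in ball x₀ r, (2 ^ n * ∫⁻ z in ball x₀ r, Φ z) =
        2 ^ n * volume (ball x₀ r) * ∫⁻ z in ball x₀ r, Φ z := by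
      rw [setLIntegral_const]; ring
    rw [← hconst]
    rcases le_total s (1/2) with h | h
    · rw [lintegral_prod_symm _ hjs.aemeasurable]
      apply setLIntegral_mono' measurableSet_ball
      intro y hy
      exact seg_bound_aux x₀ r Φ hΦ y hy s ⟨hs.1, h⟩
    · rw [lintegral_prod _ hjs.aemeasurable]
      apply setLIntegral_mono' measurableSet_ball
      intro x hx
      have : ∀ y, seg x y s = seg y x (1 - s) := by
        intro y; unfold seg; rw [sub_smul, one_smul, smul_sub, smul_sub]; abel
      simp only [this]
      exact seg_bound_aux x₀ r Φ hΦ x hx (1 - s) ⟨by linarith [hs.2], by linarith⟩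
  calc _ ≤ ∫⁻ s in Icc (0:ℝ) 1, 2 ^ n * volume (ball x₀ r) * ∫⁻ z in ball x₀ r, Φ z :=
        setLIntegral_mono' measurableSet_Icc key
    _ = _ := by rw [setLIntegral_const]; simp [hμ]

open scoped ENNReal

lemma oneD (φ φ' : ℝ → ℝ) (hd : ∀ s, HasDerivAt φ (φ' s) s) (hc : Continuous φ') (t ε : ℝ)
    (h0 : t + ε ≤ |φ 0|) (h1 : |φ 1| ≤ t) :
    ENNReal.ofReal ε ≤ ∫⁻ s in Icc (0:ℝ) 1,
      {s | t < |φ s| ∧ |φ s| < t + ε}.indicator (fun s => ENNReal.ofReal |φ' s|) s := by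
  rcases le_or_gt ε 0 with hε | hε
  · simp [ENNReal.ofReal_of_nonpos hε]
  have hφc : Continuous φ := continuous_iff_continuousAt.2 fun s => (hd s).continuousAt
  have hac : Continuous fun s => |φ s| := hφc.abs
  obtain ⟨s0, ⟨hs0I, hs0⟩, hs0max⟩ := (isCompact_Icc.inter_right
    (isClosed_le continuous_const hac) : IsCompact (Icc (0:ℝ) 1 ∩ {s | t + ε ≤ |φ s|})).exists_isGreatest
    ⟨0, ⟨by simp, h0⟩⟩
  obtain ⟨s1, ⟨hs1I, hs1⟩, hs1min⟩ := (isCompact_Icc.inter_right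
    (isClosed_le hac continuous_const) : IsCompact (Icc s0 1 ∩ {s | |φ s| ≤ t})).exists_isLeast
    ⟨1, ⟨by simpa using hs0I.2, h1⟩⟩
  simp only [mem_ofPred_eq] at hs0 hs1
  have hmid : ∀ s ∈ Ioo s0 s1, t < |φ s| ∧ |φ s| < t + ε := by
    intro s hs
    constructor
    · by_contra hcon
      push Not at hcon
      exact absurd (hs1min ⟨⟨hs.1.le, hs.2.le.trans hs1I.2⟩, hcon⟩) (not_le.2 hs.2)
    · by_contra hcon
      push Not at hcon
      exact absurd (hs0max ⟨⟨hs0I.1.trans hs.1.le, hs.2.le.trans hs1I.2⟩, hcon⟩) (not_le.2 hs.1)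
  have hftc : ∫ s in s0..s1, φ' s = φ s1 - φ s0 :=
    intervalIntegral.integral_eq_sub_of_hasDerivAt (fun s _ => hd s) (hc.intervalIntegrable _ _)
  have hε1 : ε ≤ ∫ s in s0..s1, |φ' s| := by
    calc ε ≤ |φ s0| - |φ s1| := by linarith
      _ ≤ |φ s0 - φ s1| := abs_sub_abs_le_abs_sub _ _
      _ = |∫ s in s0..s1, φ' s| := by rw [hftc, abs_sub_comm]
      _ ≤ ∫ s in s0..s1, |φ' s| := intervalIntegral.abs_integral_le_integral_abs hs1I.1
  rw [intervalIntegral.integral_of_le hs1I.1, integral_Ioc_eq_integral_Ioo] at hε1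
  have hint : IntegrableOn (fun s => |φ' s|) (Ioo s0 s1) :=
    (hc.abs.integrableOn_Icc).mono_set Ioo_subset_Icc_self
  calc ENNReal.ofReal ε ≤ ENNReal.ofReal (∫ s in Ioo s0 s1, |φ' s|) := ENNReal.ofReal_le_ofReal hε1
    _ = ∫⁻ s in Ioo s0 s1, ENNReal.ofReal |φ' s| :=
        ofReal_integral_eq_lintegral_ofReal hint (Filter.Eventually.of_forall fun s => abs_nonneg _)
    _ = ∫⁻ s in Ioo s0 s1, 
      {s | t < |φ s| ∧ |φ s| < t + ε}.indicator (fun s => ENNReal.ofReal |φ' s|) s := by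
        apply setLIntegral_congr_fun measurableSet_Ioo
        intro s hs
        simp only
        rw [indicator_of_mem]
        exact hmid s hs
    _ ≤ _ := lintegral_mono_set
        (Ioo_subset_Icc_self.trans (Icc_subset_Icc hs0I.1 hs1I.2))

/-- log kernel -/
noncomputable def LL {n : ℕ} (x₀ : EE n) (r : ℝ) (z y : EE n) : ℝ :=
  Real.log (5 * (‖x₀ - y‖ + r) / ‖z - y‖)

lemma seg_log {n : ℕ} (x₀ x x' y : EE n) (r s₀ : ℝ) (hx : x ∈ ball x₀ r) (hx' : x' ∈ ball x₀ r)
    (hs₀ : s₀ ∈ Icc (0:ℝ) 1) :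
    ENNReal.ofReal (LL x₀ r (seg x x' s₀) y) ≤ ENNReal.ofReal 100 *
      (1 + ∫⁻ s in Icc (0:ℝ) 1, ENNReal.ofReal ((r / ‖seg x x' s - y‖) ^ (3/2 : ℝ))) := by
  have hr : 0 < r := pos_of_mem_ball hx
  set z := seg x x' s₀ with hz
  have hzB : z ∈ ball x₀ r := seg_mem hx hx' hs₀
  set d := ‖z - y‖ with hd
  have hd0 : 0 ≤ d := norm_nonneg _
  rcases hd0.eq_or_lt with h0 | hdpos
  · unfold LL; rw [← hd, ← h0]; simp
  clear_value d
  have hzx : ‖x₀ - z‖ < r := by rw [← dist_eq_norm, dist_comm]; exact hzB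
  have hxx : ‖x' - x‖ ≤ 2 * r := by
    have := dist_triangle_right x' x x₀
    rw [← dist_eq_norm]; linarith [mem_ball.1 hx, mem_ball.1 hx']
  have hLub : LL x₀ r z y ≤ Real.log (5 + 10 * (r / d)) := by
    unfold LL
    rw [← hd]
    apply Real.log_le_log (by positivity)
    rw [div_le_iff₀ hdpos]
    have h2 : ‖x₀ - y‖ ≤ ‖x₀ - z‖ + d := by
      rw [hd]; simpa using norm_add_le (x₀ - z) (z - y)
    have : (5 + 10 * (r / d)) * d = 5 * d + 10 * r := by field_simp
    rw [this]; linarith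
  rcases le_or_gt (4 * r) d with hbig | hsmall
  · have : LL x₀ r z y ≤ 100 := by
      refine hLub.trans ?_
      have hq : r / d ≤ 1/4 := by rw [div_le_iff₀ hdpos]; linarith
      have := Real.log_le_sub_one_of_pos (show 0 < 5 + 10 * (r/d) by positivity)
      linarith
    calc _ ≤ ENNReal.ofReal 100 * 1 := by rw [mul_one]; exact ENNReal.ofReal_le_ofReal this
      _ ≤ _ := by gcongr; exact le_self_add
  · set τ := d / (4 * r) with hτ
    have hτ0 : 0 < τ := by positivity
    have hτ1 : τ < 1 := by rw [hτ, div_lt_one (by positivity)]; exact hsmall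
    set q := r / d with hq
    have hq0 : 0 < q := by positivity
    have hqτ : τ = 1 / (4 * q) := by rw [hτ, hq]; field_simp
    have hq4 : 1/4 < q := by rw [hq, lt_div_iff₀ hdpos]; linarith
    obtain ⟨c, hc0, hc1, hc2, hc3⟩ : ∃ c, 0 ≤ c ∧ c + τ ≤ 1 ∧ c ≤ s₀ ∧ s₀ ≤ c + τ := by
      rcases le_total s₀ (1 - τ) with h | h
      · exact ⟨s₀, hs₀.1, by linarith, le_rfl, by linarith⟩
      · exact ⟨1 - τ, by linarith, by linarith, h, by linarith [hs₀.2]⟩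
    have hlow : ∀ s ∈ Icc c (c + τ), ENNReal.ofReal ((2/3 * q) ^ (3/2:ℝ)) ≤
        ENNReal.ofReal ((r / ‖seg x x' s - y‖) ^ (3/2 : ℝ)) := by
      intro s hs
      have e : seg x x' s - z = (s - s₀) • (x' - x) := by
        rw [hz]; unfold seg; rw [sub_smul]; abel
      have hsτ : |s - s₀| ≤ τ := by rw [abs_le]; constructor <;> linarith [hs.1, hs.2]
      have h1 : ‖seg x x' s - z‖ ≤ d / 2 := by
        rw [e, norm_smul, Real.norm_eq_abs]
        calc |s - s₀| * ‖x' - x‖ ≤ τ * (2 * r) := by gcongr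
          _ = d / 2 := by rw [hτ]; field_simp; norm_num
      have e2 : seg x x' s - y = (seg x x' s - z) + (z - y) := by abel
      have h2 : ‖seg x x' s - y‖ ≤ 3/2 * d := by
        rw [e2]; refine (norm_add_le _ _).trans ?_; linarith
      have h3 : d / 2 ≤ ‖seg x x' s - y‖ := by
        have := norm_sub_le (seg x x' s - y) (seg x x' s - z)
        have e3 : seg x x' s - y - (seg x x' s - z) = z - y := by abel
        rw [e3] at this; linarith
      apply ENNReal.ofReal_le_ofReal
      apply Real.rpow_le_rpow (by positivity) _ (by norm_num)
      rw [le_div_iff₀ (by linarith), hq]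
      calc 2/3 * (r / d) * ‖seg x x' s - y‖ ≤ 2/3 * (r / d) * (3/2 * d) := by gcongr
        _ = r := by field_simp
    have hI : ENNReal.ofReal (τ * (2/3 * q) ^ (3/2:ℝ)) ≤
        ∫⁻ s in Icc (0:ℝ) 1, ENNReal.ofReal ((r / ‖seg x x' s - y‖) ^ (3/2 : ℝ)) := by
      calc _ = ∫⁻ s in Icc c (c + τ), ENNReal.ofReal ((2/3 * q) ^ (3/2:ℝ)) := by
            rw [setLIntegral_const, Real.volume_Icc, mul_comm, ENNReal.ofReal_mul (by positivity)]
            congr 2; ring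
        _ ≤ ∫⁻ s in Icc c (c + τ), ENNReal.ofReal ((r / ‖seg x x' s - y‖) ^ (3/2 : ℝ)) :=
            setLIntegral_mono' measurableSet_Icc hlow
        _ ≤ _ := lintegral_mono_set (Icc_subset_Icc hc0 hc1)
    have hreal : LL x₀ r z y ≤ 100 * (τ * (2/3 * q) ^ (3/2:ℝ)) := by
      refine hLub.trans ?_
      have e1 : (2/3 * q) ^ (3/2:ℝ) = (2/3 * q) * Real.sqrt (2/3 * q) := by
        rw [show (3/2:ℝ) = 1 + 1/2 by norm_num, Real.rpow_add (by positivity), Real.rpow_one,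
          ← Real.sqrt_eq_rpow]
      have e2 : 100 * (τ * ((2/3 * q) * Real.sqrt (2/3 * q))) = 50/3 * Real.sqrt (2/3*q) := by
        rw [hqτ]; field_simp; norm_num
      rw [e1, e2]
      have h30 : Real.log (5 + 10 * q) ≤ 2 * Real.sqrt (30 * q) := by
        calc Real.log (5 + 10 * q) ≤ Real.log (30 * q) := Real.log_le_log (by positivity) (by linarith)
          _ = 2 * Real.log (Real.sqrt (30 * q)) := by
              rw [Real.log_sqrt (by positivity)]; ring
          _ ≤ 2 * Real.sqrt (30 * q) := by
              have := Real.log_le_sub_one_of_pos (show 0 < Real.sqrt (30 * q) by positivity)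
              linarith
      refine h30.trans ?_
      have : Real.sqrt (30 * q) ≤ 25/3 * Real.sqrt (2/3 * q) := by
        rw [show (25/3 : ℝ) = Real.sqrt ((25/3)^2) by rw [Real.sqrt_sq (by norm_num)],
          ← Real.sqrt_mul (by norm_num)]
        apply Real.sqrt_le_sqrt; linarith
      linarith
    calc _ ≤ ENNReal.ofReal (100 * (τ * (2/3 * q) ^ (3/2:ℝ))) := ENNReal.ofReal_le_ofReal hreal
      _ = ENNReal.ofReal 100 * ENNReal.ofReal (τ * (2/3 * q) ^ (3/2:ℝ)) :=
          ENNReal.ofReal_mul (by norm_num)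
      _ ≤ _ := by gcongr; exact hI.trans le_add_self

open scoped ENNReal

lemma local_ineq (n : ℕ) (hn : 2 ≤ n) (a b κ : ℝ) (ha : 0 ≤ a) (hb : 0 ≤ b) (hκ : 0 < κ) :
    ∃ C : ℝ, 0 < C ∧ ∀ (N v : EE n → ℝ) (k : ℝ) (x₀ : EE n) (r : ℝ) (h : EE n → ℝ) (t ε : ℝ),
      0 < r → 0 < ε → Measurable N → Measurable v → ContDiff ℝ 1 h →
      ∫⁻ y, ENNReal.ofReal (N y) ≤ ENNReal.ofReal b →
      (∀ z ∈ ball x₀ r, ENNReal.ofReal (k - v z) ≤ ENNReal.ofReal a +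
        ∫⁻ y, ENNReal.ofReal (LL x₀ r z y) * ENNReal.ofReal (N y)) →
      ENNReal.ofReal κ * volume (ball x₀ r) ≤ volume (ball x₀ r ∩ {z | t + ε ≤ |h z|}) →
      ENNReal.ofReal κ * volume (ball x₀ r) ≤ volume (ball x₀ r ∩ {z | |h z| ≤ t}) →
      ENNReal.ofReal (ε * r ^ (n - 1) * Real.exp (((n:ℝ) - 1) * k)) ≤ ENNReal.ofReal C *
        ∫⁻ z in ball x₀ r, {z | t < |h z| ∧ |h z| < t + ε}.indicator
          (fun z => ENNReal.ofReal (‖fderiv ℝ h z‖ * Real.exp (((n:ℝ) - 1) * v z))) z := by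
  obtain ⟨K, hK0, hK⟩ := kernel_bound n hn (3/2) (by norm_num)
    (by have : (2:ℝ) ≤ n := by exact_mod_cast hn
        linarith)
  set V : ℝ := (volume (ball (0 : EE n) 1)).toReal with hV
  have hV' : volume (ball (0 : EE n) 1) = ENNReal.ofReal V := by
    rw [hV, ENNReal.ofReal_toReal measure_ball_lt_top.ne]
  have hV0 : 0 < V := ENNReal.toReal_pos (measure_ball_pos _ _ one_pos).ne' measure_ball_lt_top.ne
  set M : ℝ := 2 ^ n * (b * K / V) * 2 / κ ^ 2 + 1 with hM
  have hM0 : 0 < M := by positivity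
  set M' : ℝ := a + 100 * (b + M) with hM'
  have hM'0 : 0 ≤ M' := by positivity
  refine ⟨2 ^ (n + 2) * Real.exp (((n:ℝ) - 1) * M') / (κ ^ 2 * V), by positivity, ?_⟩
  intro N v k x₀ r h t ε hr hε hN hv hh hNb hvk hA hD
  set B := ball x₀ r with hB
  set ν := (volume.restrict B).prod (volume.restrict B) with hν
  have hn1 : (0:ℝ) ≤ (n:ℝ) - 1 := by
    have : (2:ℝ) ≤ n := by exact_mod_cast hn
    linarith
  have hvolB : volume B = ENNReal.ofReal (V * r ^ n) := by
    rw [hB, vol_ball _ hr, hV', ← ENNReal.ofReal_mul (by positivity)]; congr 1; ring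
  -- potential
  set Φ : EE n → ℝ≥0∞ := fun z => ∫⁻ y, ENNReal.ofReal ((r / ‖z - y‖) ^ (3/2 : ℝ)) *
    ENNReal.ofReal (N y) with hΦ
  have hker : Measurable (fun q : EE n × EE n => ENNReal.ofReal ((r / ‖q.1 - q.2‖) ^ (3/2 : ℝ)) *
    ENNReal.ofReal (N q.2)) := by fun_prop
  have hΦm : Measurable Φ := hker.lintegral_prod_right'
  have hΦB : ∫⁻ z in B, Φ z ≤ ENNReal.ofReal (b * (K * r ^ n)) := by
    rw [hΦ, lintegral_lintegral_swap hker.aemeasurable]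
    calc ∫⁻ y, ∫⁻ z in B, ENNReal.ofReal ((r / ‖z - y‖) ^ (3/2 : ℝ)) * ENNReal.ofReal (N y) 
        = ∫⁻ y, (∫⁻ z in B, ENNReal.ofReal ((r / ‖z - y‖) ^ (3/2 : ℝ))) * ENNReal.ofReal (N y) := by
          congr 1; ext y
          rw [lintegral_mul_const]; fun_prop
      _ ≤ ∫⁻ y, ENNReal.ofReal (K * r ^ n) * ENNReal.ofReal (N y) := by
          apply lintegral_mono; intro y
          simp only
          gcongr; exact hK x₀ y r hr
      _ = ENNReal.ofReal (K * r ^ n) * ∫⁻ y, ENNReal.ofReal (N y) := by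
          rw [lintegral_const_mul]; fun_prop
      _ ≤ ENNReal.ofReal (K * r ^ n) * ENNReal.ofReal b := by gcongr
      _ = _ := by rw [← ENNReal.ofReal_mul (by positivity), mul_comm]
  set Ψ : EE n × EE n → ℝ≥0∞ := fun q => ∫⁻ s in Icc (0:ℝ) 1, Φ (seg q.1 q.2 s) with hΨ
  have hΨm : Measurable Ψ := (hΦm.comp seg_meas).lintegral_prod_right'
  have hΨB : ∫⁻ q, Ψ q ∂ν ≤ ENNReal.ofReal (2 ^ n * (V * r ^ n) * (b * (K * r ^ n))) := by
    refine (seg_bound x₀ r Φ hΦm).trans ?_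
    rw [← hB, hvolB]
    calc _ ≤ 2 ^ n * ENNReal.ofReal (V * r ^ n) * ENNReal.ofReal (b * (K * r ^ n)) := by gcongr
      _ = _ := by
        rw [ENNReal.ofReal_mul (p := 2 ^ n * (V * r ^ n)) (by positivity),
          ENNReal.ofReal_mul (p := 2 ^ n) (by positivity), ENNReal.ofReal_pow (p := 2) (by norm_num)]
        simp only [ENNReal.ofReal_ofNat]
  set T : Set (EE n × EE n) := {q | ENNReal.ofReal M ≤ Ψ q} with hT
  have hTm : MeasurableSet T := measurableSet_le measurable_const hΨm
  have hTν : ν T ≤ ENNReal.ofReal (κ ^ 2 / 2 * (V * r ^ n) ^ 2) := by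
    have h1 := mul_meas_ge_le_lintegral (μ := ν) hΨm (ENNReal.ofReal M)
    have h2 := h1.trans hΨB
    have h3 : ν T ≤ ENNReal.ofReal (2 ^ n * (V * r ^ n) * (b * (K * r ^ n))) / ENNReal.ofReal M := by
      rw [ENNReal.le_div_iff_mul_le (Or.inl (by simpa using hM0)) (Or.inl ENNReal.ofReal_ne_top),
        mul_comm]
      exact h2
    refine h3.trans ?_
    rw [← ENNReal.ofReal_div_of_pos hM0]
    apply ENNReal.ofReal_le_ofReal
    rw [div_le_iff₀ hM0, hM]
    have e : κ ^ 2 / 2 * (V * r ^ n) ^ 2 * (2 ^ n * (b * K / V) * 2 / κ ^ 2 + 1) =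
      2 ^ n * (V * r ^ n) * (b * (K * r ^ n)) + κ ^ 2 / 2 * (V * r ^ n) ^ 2 := by
      field_simp
    rw [e]
    have : 0 ≤ κ ^ 2 / 2 * (V * r ^ n) ^ 2 := by positivity
    linarith
  have hhc : Continuous h := hh.continuous
  have hfd : Continuous (fderiv ℝ h) := hh.continuous_fderiv (by norm_num)
  set A := {z | t + ε ≤ |h z|} with hAdef
  set D := {z | |h z| ≤ t} with hDdef
  have hAm : MeasurableSet A := measurableSet_le measurable_const hhc.abs.measurable
  have hDm : MeasurableSet D := measurableSet_le hhc.abs.measurable measurable_const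
  set G : Set (EE n × EE n) := ((B ∩ A) ×ˢ (B ∩ D)) \ T with hG
  have hBm : MeasurableSet B := measurableSet_ball
  have hGm : MeasurableSet G := ((hBm.inter hAm).prod (hBm.inter hDm)).diff hTm
  have hAD : ENNReal.ofReal (κ ^ 2 * (V * r ^ n) ^ 2) ≤ ν ((B ∩ A) ×ˢ (B ∩ D)) := by
    rw [hν, Measure.prod_prod, Measure.restrict_apply (hBm.inter hAm),
      Measure.restrict_apply (hBm.inter hDm), inter_eq_left.2 (inter_subset_left),
      inter_eq_left.2 (inter_subset_left)]
    calc _ = (ENNReal.ofReal κ * volume B) * (ENNReal.ofReal κ * volume B) := by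
          rw [hvolB, ← ENNReal.ofReal_mul hκ.le, ← ENNReal.ofReal_mul (by positivity)]
          congr 1; ring
      _ ≤ _ := mul_le_mul' hA hD
  have hGν : ENNReal.ofReal (κ ^ 2 / 2 * (V * r ^ n) ^ 2) ≤ ν G := by
    have h1 : ν ((B ∩ A) ×ˢ (B ∩ D)) ≤ ν G + ν T :=
      (measure_mono (by rw [hG, sdiff_union_self]; exact subset_union_left)).trans (measure_union_le _ _)
    have h2 := hAD.trans (h1.trans (add_le_add_right hTν _))
    have e : κ ^ 2 * (V * r ^ n) ^ 2 = κ ^ 2 / 2 * (V * r ^ n) ^ 2 + κ ^ 2 / 2 * (V * r ^ n) ^ 2 := by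
      ring
    rw [e, ENNReal.ofReal_add (by positivity) (by positivity)] at h2
    exact (ENNReal.add_le_add_iff_right ENNReal.ofReal_ne_top).1 h2
  set Θ : EE n → ℝ≥0∞ := {z | t < |h z| ∧ |h z| < t + ε}.indicator
          (fun z => ENNReal.ofReal (‖fderiv ℝ h z‖ * Real.exp (((n:ℝ) - 1) * v z))) with hΘ
  have hΘm : Measurable Θ := by
    apply Measurable.indicator
    · have := hfd.norm.measurable
      fun_prop
    · exact (measurableSet_lt measurable_const hhc.abs.measurable).inter
        (measurableSet_lt hhc.abs.measurable measurable_const)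
  set c₁ : ℝ := 2 * r * Real.exp (((n:ℝ) - 1) * M') with hc₁
  have hgood : ∀ q ∈ G, ENNReal.ofReal (ε * Real.exp (((n:ℝ) - 1) * k)) ≤
      ENNReal.ofReal c₁ * ∫⁻ s in Icc (0:ℝ) 1, Θ (seg q.1 q.2 s) := by
    rintro ⟨x, x'⟩ ⟨⟨⟨hxB, hxA⟩, ⟨hx'B, hx'D⟩⟩, hqT⟩
    simp only at hxB hxA hx'B hx'D ⊢
    have hxx : ‖x' - x‖ ≤ 2 * r := by
      have := dist_triangle_right x' x x₀
      rw [← dist_eq_norm]; linarith [mem_ball.1 hxB, mem_ball.1 hx'B]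
    have hΨq : Ψ (x, x') < ENNReal.ofReal M := not_le.1 hqT
    -- lower bound of v on segment
    have hvs : ∀ s ∈ Icc (0:ℝ) 1, k - v (seg x x' s) ≤ M' := by
      intro s hs
      have h1 := hvk _ (seg_mem hxB hx'B hs)
      have h2 : ∫⁻ y, ENNReal.ofReal (LL x₀ r (seg x x' s) y) * ENNReal.ofReal (N y) ≤
          ENNReal.ofReal 100 * (ENNReal.ofReal b + Ψ (x, x')) := by
        calc _ ≤ ∫⁻ y, ENNReal.ofReal 100 * (1 + ∫⁻ s in Icc (0:ℝ) 1,
                ENNReal.ofReal ((r / ‖seg x x' s - y‖) ^ (3/2 : ℝ))) * ENNReal.ofReal (N y) := by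
              apply lintegral_mono; intro y
              simp only
              gcongr; exact seg_log x₀ x x' y r s hxB hx'B hs
          _ = ∫⁻ y, ENNReal.ofReal 100 * (ENNReal.ofReal (N y) + ∫⁻ s in Icc (0:ℝ) 1,
                ENNReal.ofReal ((r / ‖seg x x' s - y‖) ^ (3/2 : ℝ)) * ENNReal.ofReal (N y)) := by
              congr 1; ext y
              rw [lintegral_mul_const _ (by unfold seg; fun_prop)]; ring
          _ = ENNReal.ofReal 100 * ((∫⁻ y, ENNReal.ofReal (N y)) + ∫⁻ y, ∫⁻ s in Icc (0:ℝ) 1,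
                ENNReal.ofReal ((r / ‖seg x x' s - y‖) ^ (3/2 : ℝ)) * ENNReal.ofReal (N y)) := by
              rw [lintegral_const_mul' _ _ ENNReal.ofReal_ne_top, lintegral_add_left (by fun_prop)]
          _ = ENNReal.ofReal 100 * ((∫⁻ y, ENNReal.ofReal (N y)) + Ψ (x, x')) := by
              rw [lintegral_lintegral_swap]
              unfold seg
              exact (by fun_prop : Measurable (fun q : EE n × ℝ =>
                ENNReal.ofReal ((r / ‖x + q.2 • (x' - x) - q.1‖) ^ (3/2 : ℝ)) *
                ENNReal.ofReal (N q.1))).aemeasurable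
          _ ≤ _ := by gcongr
      have h3 : ENNReal.ofReal (k - v (seg x x' s)) ≤ ENNReal.ofReal M' := by
        calc _ ≤ ENNReal.ofReal a + ENNReal.ofReal 100 * (ENNReal.ofReal b + ENNReal.ofReal M) := by
              refine h1.trans ?_
              gcongr
              refine h2.trans ?_
              gcongr
          _ = ENNReal.ofReal M' := by
              rw [← ENNReal.ofReal_add hb hM0.le, ← ENNReal.ofReal_mul (by norm_num),
                ← ENNReal.ofReal_add ha (by positivity)]
      exact (ENNReal.ofReal_le_ofReal_iff hM'0).1 h3
    have hder : ∀ s, HasDerivAt (fun s => h (seg x x' s)) (fderiv ℝ h (seg x x' s) (x' - x)) s := by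
      intro s
      have hs1 : HasDerivAt (fun s : ℝ => seg x x' s) (x' - x) s := by
        unfold seg
        simpa using ((hasDerivAt_id s).smul_const (x' - x)).const_add x
      exact ((hh.differentiable (by norm_num)) (seg x x' s)).hasFDerivAt.comp_hasDerivAt s hs1
    have hsegc : Continuous (fun s => seg x x' s) := by unfold seg; fun_prop
    have h1d := oneD (fun s => h (seg x x' s)) (fun s => fderiv ℝ h (seg x x' s) (x' - x)) hder
      ((hfd.comp hsegc).clm_apply continuous_const) t ε (by simpa [seg, hAdef] using hxA)
      (by simpa [seg, hDdef] using hx'D)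
    calc ENNReal.ofReal (ε * Real.exp (((n:ℝ) - 1) * k)) 
        = ENNReal.ofReal (Real.exp (((n:ℝ) - 1) * k)) * ENNReal.ofReal ε := by
          rw [mul_comm, ENNReal.ofReal_mul (by positivity)]
      _ ≤ ENNReal.ofReal (Real.exp (((n:ℝ) - 1) * k)) * ∫⁻ s in Icc (0:ℝ) 1,
          {s | t < |h (seg x x' s)| ∧ |h (seg x x' s)| < t + ε}.indicator
            (fun s => ENNReal.ofReal |fderiv ℝ h (seg x x' s) (x' - x)|) s := by gcongr
      _ = ∫⁻ s in Icc (0:ℝ) 1, ENNReal.ofReal (Real.exp (((n:ℝ) - 1) * k)) *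
          {s | t < |h (seg x x' s)| ∧ |h (seg x x' s)| < t + ε}.indicator
            (fun s => ENNReal.ofReal |fderiv ℝ h (seg x x' s) (x' - x)|) s := by
          rw [lintegral_const_mul' _ _ ENNReal.ofReal_ne_top]
      _ ≤ ∫⁻ s in Icc (0:ℝ) 1, ENNReal.ofReal c₁ * Θ (seg x x' s) := by
          apply setLIntegral_mono' measurableSet_Icc
          intro s hs
          by_cases hmem : t < |h (seg x x' s)| ∧ |h (seg x x' s)| < t + ε
          · rw [indicator_of_mem (by exact hmem), hΘ, indicator_of_mem (by exact hmem),
              ← ENNReal.ofReal_mul (by positivity), ← ENNReal.ofReal_mul (by positivity)]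
            apply ENNReal.ofReal_le_ofReal
            have e1 : |fderiv ℝ h (seg x x' s) (x' - x)| ≤ ‖fderiv ℝ h (seg x x' s)‖ * (2 * r) := by
              rw [← Real.norm_eq_abs]
              refine (ContinuousLinearMap.le_opNorm _ _).trans ?_
              gcongr
            have e2 : Real.exp (((n:ℝ) - 1) * k) ≤ Real.exp (((n:ℝ) - 1) * M') *
                Real.exp (((n:ℝ) - 1) * v (seg x x' s)) := by
              rw [← Real.exp_add]
              apply Real.exp_le_exp.2
              rw [← mul_add]
              apply mul_le_mul_of_nonneg_left _ hn1
              linarith [hvs s hs]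
            calc _ ≤ (Real.exp (((n:ℝ) - 1) * M') * Real.exp (((n:ℝ) - 1) * v (seg x x' s))) *
                  (‖fderiv ℝ h (seg x x' s)‖ * (2 * r)) := by gcongr
              _ = _ := by rw [hc₁]; ring
          · rw [indicator_of_notMem (by exact hmem)]; simp
      _ = _ := by rw [lintegral_const_mul' _ _ ENNReal.ofReal_ne_top]
  set I := ∫⁻ z in B, Θ z with hI
  have hfin : ENNReal.ofReal (ε * Real.exp (((n:ℝ) - 1) * k)) *
      ENNReal.ofReal (κ ^ 2 / 2 * (V * r ^ n) ^ 2) ≤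
      ENNReal.ofReal c₁ * (2 ^ n * ENNReal.ofReal (V * r ^ n) * I) := by
    calc _ ≤ ENNReal.ofReal (ε * Real.exp (((n:ℝ) - 1) * k)) * ν G := by gcongr
      _ = ∫⁻ q in G, ENNReal.ofReal (ε * Real.exp (((n:ℝ) - 1) * k)) ∂ν := by
          rw [setLIntegral_const]
      _ ≤ ∫⁻ q in G, ENNReal.ofReal c₁ * (∫⁻ s in Icc (0:ℝ) 1, Θ (seg q.1 q.2 s)) ∂ν :=
          setLIntegral_mono' hGm hgood
      _ ≤ ∫⁻ q, ENNReal.ofReal c₁ * (∫⁻ s in Icc (0:ℝ) 1, Θ (seg q.1 q.2 s)) ∂ν :=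
          lintegral_mono' Measure.restrict_le_self le_rfl
      _ = ENNReal.ofReal c₁ * ∫⁻ q, (∫⁻ s in Icc (0:ℝ) 1, Θ (seg q.1 q.2 s)) ∂ν := by
          rw [lintegral_const_mul' _ _ ENNReal.ofReal_ne_top]
      _ ≤ _ := by
          gcongr
          rw [← hvolB]
          exact seg_bound x₀ r Θ hΘm
  rcases eq_or_ne I ∞ with hIt | hIt
  · rw [hIt, ENNReal.mul_top (by simp; positivity)]; exact le_top
  obtain ⟨J, hJ0, hJ⟩ : ∃ J : ℝ, 0 ≤ J ∧ I = ENNReal.ofReal J :=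
    ⟨I.toReal, ENNReal.toReal_nonneg, (ENNReal.ofReal_toReal hIt).symm⟩
  have h2n : (2:ℝ≥0∞) ^ n = ENNReal.ofReal (2 ^ n) := by
    rw [ENNReal.ofReal_pow (by norm_num)]; simp
  rw [hJ, h2n, ← ENNReal.ofReal_mul (by positivity), ← ENNReal.ofReal_mul (by positivity),
    ← ENNReal.ofReal_mul (by positivity), ← ENNReal.ofReal_mul (by positivity),
    ENNReal.ofReal_le_ofReal_iff (by positivity)] at hfin
  rw [hJ, ← ENNReal.ofReal_mul (by positivity)]
  apply ENNReal.ofReal_le_ofReal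
  obtain ⟨m, rfl⟩ : ∃ m, n = m + 1 := ⟨n - 1, by omega⟩
  simp only [Nat.add_sub_cancel]
  rw [div_mul_eq_mul_div, le_div_iff₀ (by positivity)]
  have hpos : 0 < V * r ^ (m+1) * r / 2 := by positivity
  refine le_of_mul_le_mul_right ?_ hpos
  calc _ = ε * Real.exp ((((m+1:ℕ):ℝ) - 1) * k) * (κ ^ 2 / 2 * (V * r ^ (m+1)) ^ 2) := by ring
    _ ≤ _ := hfin
    _ = _ := by rw [hc₁]; ring

open scoped ENNReal Topology

lemma sum_rpow_le {ι : Type*} (s : Finset ι) (a : ι → ℝ≥0∞) (p : ℝ) (hp : 1 ≤ p) :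
    ∑ i ∈ s, a i ^ p ≤ (∑ i ∈ s, a i) ^ p := by
  classical
  induction s using Finset.induction_on with
  | empty => simp
  | insert i s hi ih =>
    rw [Finset.sum_insert hi, Finset.sum_insert hi]
    calc a i ^ p + ∑ j ∈ s, a j ^ p ≤ a i ^ p + (∑ j ∈ s, a j) ^ p := by gcongr
      _ ≤ _ := ENNReal.add_rpow_le_rpow_add _ _ hp

lemma tsum_rpow_le {ι : Type*} (a : ι → ℝ≥0∞) (p : ℝ) (hp : 1 ≤ p) :
    ∑' i, a i ^ p ≤ (∑' i, a i) ^ p := by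
  rw [ENNReal.tsum_eq_iSup_sum]
  refine iSup_le fun s => (sum_rpow_le s a p hp).trans ?_
  apply ENNReal.rpow_le_rpow (ENNReal.sum_le_tsum s) (by linarith)

lemma balanced {n : ℕ} (hn : 2 ≤ n) (O : Set (EE n)) (hO : IsOpen O) (hfin : volume O ≠ ∞)
    (x : EE n) (hx : x ∈ O) : ∃ r : ℝ, 0 < r ∧
      ENNReal.ofReal ((2 ^ (n+1))⁻¹) * volume (ball x r) ≤ volume (ball x r ∩ O) ∧
      ENNReal.ofReal ((2 ^ (n+2))⁻¹) * volume (ball x r) ≤ volume (ball x r ∩ Oᶜ) := by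
  obtain ⟨r0, hr0, hsub⟩ := Metric.isOpen_iff.1 hO x hx
  have hrj : ∀ j : ℕ, 0 < 2 ^ j * r0 := fun j => by positivity
  set V : ℝ := (volume (ball (0 : EE n) 1)).toReal with hV
  have hV' : volume (ball (0 : EE n) 1) = ENNReal.ofReal V := by
    rw [hV, ENNReal.ofReal_toReal measure_ball_lt_top.ne]
  have hV0 : 0 < V := ENNReal.toReal_pos (measure_ball_pos _ _ one_pos).ne' measure_ball_lt_top.ne
  have hvol : ∀ r, 0 < r → volume (ball x r) = ENNReal.ofReal (r ^ n * V) := fun r hr => by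
    rw [vol_ball x hr, hV', ← ENNReal.ofReal_mul (by positivity)]
  have hsplit : ∀ r, volume (ball x r ∩ O) + volume (ball x r ∩ Oᶜ) = volume (ball x r) := fun r => by
    rw [← sdiff_eq]; exact measure_inter_add_sdiff _ hO.measurableSet
  have hhalf : ∀ r, 0 < r → ENNReal.ofReal (1/2) * volume (ball x r) +
      ENNReal.ofReal (1/2) * volume (ball x r) = volume (ball x r) := fun r hr => by
    rw [← add_mul, ← ENNReal.ofReal_add (by norm_num) (by norm_num)]; norm_num
  have hex : ∃ j : ℕ, ENNReal.ofReal (1/2) * volume (ball x (2 ^ j * r0)) ≤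
      volume (ball x (2 ^ j * r0) ∩ Oᶜ) := by
    set W := (volume O).toReal
    have hW : volume O = ENNReal.ofReal W := (ENNReal.ofReal_toReal hfin).symm
    obtain ⟨j, hj⟩ := pow_unbounded_of_one_lt (2 * W / (r0 ^ n * V)) (one_lt_two)
    refine ⟨j, ?_⟩
    have h1 : volume O ≤ ENNReal.ofReal (1/2) * volume (ball x (2 ^ j * r0)) := by
      rw [hW, hvol _ (hrj j), ← ENNReal.ofReal_mul (by norm_num)]
      apply ENNReal.ofReal_le_ofReal
      rw [div_lt_iff₀ (by positivity)] at hj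
      have h2 : (2:ℝ) ^ j ≤ (2 ^ j) ^ n := by
        apply le_self_pow₀ (one_le_pow₀ (by norm_num)) (by omega)
      rw [mul_pow]
      have : (2:ℝ) ^ j * (r0 ^ n * V) ≤ (2 ^ j) ^ n * (r0 ^ n * V) := by gcongr
      linarith
    have h3 := hsplit (2 ^ j * r0)
    by_contra hcon
    push Not at hcon
    have h4 : volume (ball x (2 ^ j * r0) ∩ O) ≤ ENNReal.ofReal (1/2) * volume (ball x (2 ^ j * r0)) :=
      (measure_mono inter_subset_right).trans h1
    have h5 := ENNReal.add_lt_add_of_le_of_lt (ne_top_of_le_ne_top hfin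
      (measure_mono inter_subset_right)) h4 hcon
    rw [h3, hhalf _ (hrj j)] at h5
    exact lt_irrefl _ h5
  classical
  obtain ⟨i, hi⟩ : ∃ i, Nat.find hex = i + 1 := by
    apply Nat.exists_eq_succ_of_ne_zero
    intro h0
    have := Nat.find_spec hex
    rw [h0] at this
    simp only [pow_zero, one_mul] at this
    have e : ball x r0 ∩ Oᶜ = ∅ := by
      rw [← disjoint_iff_inter_eq_empty]; exact disjoint_compl_right_iff_subset.2 hsub
    rw [e, measure_empty, hvol _ hr0, ← ENNReal.ofReal_mul (by norm_num)] at this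
    simp only [nonpos_iff_eq_zero, ENNReal.ofReal_eq_zero] at this
    have h' : 0 < 1/2 * (r0 ^ n * V) := by positivity
    linarith
  have hspec := Nat.find_spec hex
  have hmin := Nat.find_min hex (m := i) (by omega)
  rw [hi] at hspec
  push Not at hmin
  refine ⟨2 ^ (i+1) * r0, by positivity, ?_, ?_⟩
  · have h3 := hsplit (2 ^ i * r0)
    have h4 : ENNReal.ofReal (1/2) * volume (ball x (2 ^ i * r0)) ≤ volume (ball x (2 ^ i * r0) ∩ O) := by
      by_contra hcon
      push Not at hcon
      have h5 := ENNReal.add_lt_add hcon hmin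
      rw [h3, hhalf _ (hrj i)] at h5
      exact lt_irrefl _ h5
    calc _ = ENNReal.ofReal (1/2) * volume (ball x (2 ^ i * r0)) := by
          rw [hvol _ (hrj _), hvol _ (hrj _), ← ENNReal.ofReal_mul (by positivity),
            ← ENNReal.ofReal_mul (by positivity)]
          congr 1
          rw [pow_succ 2 i, mul_assoc (2 ^ i), mul_pow (2 ^ i), mul_pow, mul_pow, pow_succ 2 n]
          field_simp
      _ ≤ _ := h4
      _ ≤ _ := by
          apply measure_mono
          apply inter_subset_inter_left
          apply ball_subset_ball
          rw [pow_succ]; nlinarith [hrj i]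
  · refine le_trans ?_ hspec
    gcongr
    rw [one_div]
    apply inv_anti₀ (by norm_num)
    calc (2:ℝ) = 2 ^ 1 := by norm_num
      _ ≤ _ := pow_le_pow_right₀ (by norm_num) (by omega)

/-- gradient density on a level band -/
noncomputable def TH {n : ℕ} (h v : EE n → ℝ) (t t' : ℝ) : EE n → ℝ≥0∞ :=
  {z | t < |h z| ∧ |h z| < t'}.indicator
    (fun z => ENNReal.ofReal (‖fderiv ℝ h z‖ * Real.exp (((n:ℝ) - 1) * v z)))

lemma eps_small {n : ℕ} (h : EE n → ℝ) (hhc : Continuous h) (t : ℝ) (x : EE n) (r : ℝ) (hr : 0 < r)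
    (hA : ENNReal.ofReal ((2 ^ (n+1))⁻¹) * volume (ball x r) ≤ volume (ball x r ∩ {z | t < |h z|})) :
    ∀ᶠ ε in 𝓝[>] (0:ℝ), ENNReal.ofReal ((2 ^ (n+2))⁻¹) * volume (ball x r) ≤
      volume (ball x r ∩ {z | t + ε ≤ |h z|}) := by
  have hmono : Monotone (fun m : ℕ => ball x r ∩ {z | t + 1 / ((m:ℝ) + 1) ≤ |h z|}) := by
    intro m m' hm z hz
    refine ⟨hz.1, ?_⟩
    have : 1 / ((m':ℝ) + 1) ≤ 1 / ((m:ℝ) + 1) := Nat.one_div_le_one_div hm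
    have h2 : t + 1 / ((m:ℝ) + 1) ≤ |h z| := hz.2
    show t + 1 / ((m':ℝ) + 1) ≤ |h z|
    linarith
  have hU : (⋃ m : ℕ, ball x r ∩ {z | t + 1 / ((m:ℝ) + 1) ≤ |h z|}) = ball x r ∩ {z | t < |h z|} := by
    ext z
    simp only [mem_iUnion, mem_inter_iff, exists_and_left]
    refine and_congr_right fun _ => ?_
    constructor
    · rintro ⟨m, hm⟩
      have hm' : t + 1 / ((m:ℝ) + 1) ≤ |h z| := hm
      have : 0 < 1 / ((m:ℝ) + 1) := by positivity
      show t < |h z|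
      linarith
    · intro hz
      have hz' : t < |h z| := hz
      obtain ⟨m, hm⟩ := exists_nat_one_div_lt (sub_pos.2 hz')
      refine ⟨m, ?_⟩
      show t + 1 / ((m:ℝ) + 1) ≤ |h z|
      linarith
  have hlim := tendsto_measure_iUnion_atTop (μ := (volume : Measure (EE n))) hmono
  rw [hU] at hlim
  have hlt : ENNReal.ofReal ((2 ^ (n+2))⁻¹) * volume (ball x r) < volume (ball x r ∩ {z | t < |h z|}) := by
    refine lt_of_lt_of_le ?_ hA
    have hp : volume (ball x r) ≠ 0 := (measure_ball_pos _ _ hr).ne'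
    have hf : volume (ball x r) ≠ ∞ := measure_ball_lt_top.ne
    rw [ENNReal.mul_lt_mul_iff_left hp hf]
    rw [ENNReal.ofReal_lt_ofReal_iff (by positivity)]
    exact inv_strictAnti₀ (by positivity) (pow_lt_pow_right₀ (by norm_num) (by omega))
  obtain ⟨m, hm⟩ := (hlim.eventually (lt_mem_nhds hlt)).exists
  have : Ioo (0:ℝ) (1 / ((m:ℝ) + 1)) ∈ 𝓝[>] (0:ℝ) := Ioo_mem_nhdsGT (by positivity)
  filter_upwards [this] with ε hε
  refine hm.le.trans (measure_mono ?_)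
  intro z hz
  refine ⟨hz.1, ?_⟩
  have h2 : t + 1 / ((m:ℝ) + 1) ≤ |h z| := hz.2
  show t + ε ≤ |h z|
  linarith [hε.2]

lemma lint_biUnion_le {n : ℕ} {ι : Type*} (U : Finset ι) (s : ι → Set (EE n)) (f : EE n → ℝ≥0∞) :
    ∫⁻ z in ⋃ x ∈ U, s x, f z ≤ ∑ x ∈ U, ∫⁻ z in s x, f z := by
  classical
  induction U using Finset.induction_on with
  | empty => simp
  | insert i U hi ih =>
    rw [Finset.set_biUnion_insert, Finset.sum_insert hi]
    exact (lintegral_union_le _ _ _).trans (by gcongr)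

lemma weak_step {n : ℕ} (hn : 2 ≤ n) (h v : EE n → ℝ) (hh : ContDiff ℝ 1 h)
    (hsupp : HasCompactSupport h) (hv : Measurable v) (k : EE n → ℝ → ℝ) (CF CE : ℝ)
    (hCF : 0 < CF) (hCE : 0 < CE)
    (hU : ∀ x r, 0 < r → ∫⁻ z in ball x (5 * r), ENNReal.ofReal (Real.exp (n * v z)) ≤
      ENNReal.ofReal (CF * (r ^ n * Real.exp (n * k x r))))
    (hloc : ∀ x r t ε, 0 < r → 0 < ε →
      ENNReal.ofReal ((2 ^ (n+2))⁻¹) * volume (ball x r) ≤ volume (ball x r ∩ {z | t + ε ≤ |h z|}) →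
      ENNReal.ofReal ((2 ^ (n+2))⁻¹) * volume (ball x r) ≤ volume (ball x r ∩ {z | |h z| ≤ t}) →
      ENNReal.ofReal (ε * r ^ (n - 1) * Real.exp (((n:ℝ) - 1) * k x r)) ≤ ENNReal.ofReal CE *
        ∫⁻ z in ball x r, TH h v t (t + ε) z)
    (t t' : ℝ) (ht : 0 < t) (htt' : t < t') :
    ∀ᶠ ε in 𝓝[>] (0:ℝ), ENNReal.ofReal ε *
      (∫⁻ z in {z | t' ≤ |h z|}, ENNReal.ofReal (Real.exp (n * v z))) ^ (((n:ℝ) - 1) / n) ≤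
      ENNReal.ofReal (CF ^ (((n:ℝ) - 1) / n) * CE) * ∫⁻ z, TH h v t (t + ε) z := by
  have hhc : Continuous h := hh.continuous
  have hn2 : (2:ℝ) ≤ n := by exact_mod_cast hn
  have hn0 : (0:ℝ) < n := by linarith
  have hn1 : (0:ℝ) < (n:ℝ) - 1 := by linarith
  have hOo : IsOpen {z | t < |h z|} := isOpen_lt continuous_const hhc.abs
  have hsub : ∀ s, 0 < s → {z | s ≤ |h z|} ⊆ tsupport h := by
    intro s hs z hz
    apply subset_tsupport
    intro h0
    have hz' : s ≤ |h z| := hz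
    rw [h0] at hz'; simp at hz'; linarith
  have hOfin : volume {z | t < |h z|} ≠ ∞ := by
    refine ne_top_of_le_ne_top (hsupp.isCompact.measure_lt_top (μ := volume)).ne (measure_mono ?_)
    refine Subset.trans ?_ (hsub t ht)
    intro z hz; exact le_of_lt (show t < |h z| from hz)
  have hK : IsCompact {z | t' ≤ |h z|} :=
    hsupp.isCompact.of_isClosed_subset (isClosed_le continuous_const hhc.abs)
      (hsub t' (ht.trans htt'))
  have hbal := fun x hx => balanced hn {z | t < |h z|} hOo hOfin x hx
  choose! ρ hρ using hbal
  obtain ⟨F, hFK, hFcov⟩ := hK.elim_nhds_subcover (fun x => ball x (ρ x)) (by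
    intro x hx
    exact ball_mem_nhds _ (hρ x (lt_of_lt_of_le htt' hx)).1)
  have hFρ := fun x (hx : x ∈ F) => hρ x (lt_of_lt_of_le htt' (hFK x hx))
  obtain ⟨u, huF, hdisj, hcov⟩ := Vitali.exists_disjoint_subfamily_covering_enlargement_closedBall
    (F : Set (EE n)) (fun x => x) ρ (∑ x ∈ F, ρ x)
    (fun a ha => Finset.single_le_sum (f := ρ) (fun i hi => (hFρ i hi).1.le) ha) 4 (by norm_num)
  have hufin : u.Finite := F.finite_toSet.subset huF
  obtain ⟨U, hUu⟩ : ∃ U : Finset (EE n), (U : Set (EE n)) = u := hufin.exists_finset_coe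
  have hUF : ∀ x ∈ U, x ∈ F := fun x hx => huF (hUu ▸ hx)
  have hev : ∀ᶠ ε in 𝓝[>] (0:ℝ), ∀ x ∈ F,
      ENNReal.ofReal ((2 ^ (n+2))⁻¹) * volume (ball x (ρ x)) ≤
      volume (ball x (ρ x) ∩ {z | t + ε ≤ |h z|}) := by
    rw [Filter.eventually_all_finset]
    intro x hx
    exact eps_small h hhc t x (ρ x) (hFρ x hx).1 (hFρ x hx).2.1
  filter_upwards [hev, self_mem_nhdsWithin] with ε hεF hε
  have hε0 : 0 < ε := hε
  set q : ℝ := ((n:ℝ) - 1) / n with hq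
  have hq0 : 0 < q := by positivity
  have hq1 : 1 ≤ q⁻¹ := by
    rw [hq, inv_div, le_div_iff₀ hn1]; linarith
  set A : EE n → ℝ := fun x => ρ x ^ (n - 1) * Real.exp (((n:ℝ) - 1) * k x (ρ x)) with hA
  have hKle : ∫⁻ z in {z | t' ≤ |h z|}, ENNReal.ofReal (Real.exp (n * v z)) ≤
      (∑ x ∈ U, ENNReal.ofReal (CF ^ q * A x)) ^ q⁻¹ := by
    calc _ ≤ ∫⁻ z in ⋃ x ∈ U, ball x (5 * ρ x), ENNReal.ofReal (Real.exp (n * v z)) := by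
          apply lintegral_mono_set
          intro z hz
          have := hFcov hz
          simp only [mem_iUnion, exists_prop] at this ⊢
          obtain ⟨x, hxF, hzx⟩ := this
          obtain ⟨b, hbu, hb⟩ := hcov x hxF
          have hbU : b ∈ U := by rw [← Finset.mem_coe, hUu]; exact hbu
          refine ⟨b, hbU, ?_⟩
          have h3 := hb (ball_subset_closedBall hzx)
          have h4 := (hFρ b (hUF b hbU)).1
          rw [mem_closedBall] at h3
          rw [mem_ball]; linarith
      _ ≤ ∑ x ∈ U, ∫⁻ z in ball x (5 * ρ x), ENNReal.ofReal (Real.exp (n * v z)) := by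
          exact lint_biUnion_le _ _ _
      _ ≤ ∑ x ∈ U, ENNReal.ofReal (CF ^ q * A x) ^ q⁻¹ := by
          apply Finset.sum_le_sum
          intro x hx
          have hρx := (hFρ x (hUF x hx)).1
          refine (hU x (ρ x) hρx).trans (le_of_eq ?_)
          rw [ENNReal.ofReal_rpow_of_nonneg (by positivity) (by positivity)]
          congr 1
          rw [Real.mul_rpow (by positivity) (by positivity), ← Real.rpow_mul hCF.le,
            mul_inv_cancel₀ hq0.ne', Real.rpow_one, hA]
          simp only
          rw [Real.mul_rpow (by positivity) (by positivity), ← Real.exp_mul, ← Real.rpow_natCast,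
            ← Real.rpow_natCast, ← Real.rpow_mul hρx.le]
          have e1 : ((n - 1 : ℕ) : ℝ) = (n:ℝ) - 1 := by
            rw [Nat.cast_sub (by omega)]; simp
          have e2 : ((n:ℝ) - 1) * q⁻¹ = n := by rw [hq]; field_simp
          rw [e1, e2]
          congr 3
          rw [mul_right_comm, e2]
      _ ≤ _ := sum_rpow_le _ _ _ hq1
  calc _ ≤ ENNReal.ofReal ε * ((∑ x ∈ U, ENNReal.ofReal (CF ^ q * A x)) ^ q⁻¹) ^ q := by
        gcongr
    _ = ENNReal.ofReal ε * ∑ x ∈ U, ENNReal.ofReal (CF ^ q * A x) := by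
        rw [← ENNReal.rpow_mul, inv_mul_cancel₀ hq0.ne', ENNReal.rpow_one]
    _ = ENNReal.ofReal (CF ^ q) * ∑ x ∈ U, ENNReal.ofReal (ε * ρ x ^ (n - 1) *
          Real.exp (((n:ℝ) - 1) * k x (ρ x))) := by
        rw [Finset.mul_sum, Finset.mul_sum]
        apply Finset.sum_congr rfl
        intro x hx
        rw [← ENNReal.ofReal_mul hε0.le, ← ENNReal.ofReal_mul (by positivity)]
        congr 1; rw [hA]; ring
    _ ≤ ENNReal.ofReal (CF ^ q) * ∑ x ∈ U, ENNReal.ofReal CE *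
          ∫⁻ z in ball x (ρ x), TH h v t (t + ε) z := by
        gcongr with x hx
        refine hloc x (ρ x) t ε (hFρ x (hUF x hx)).1 hε0 (hεF x (hUF x hx)) ?_
        have := (hFρ x (hUF x hx)).2.2
        have e : {z | |h z| ≤ t} = {z | t < |h z|}ᶜ := by ext z; simp
        rw [e]; exact this
    _ = ENNReal.ofReal (CF ^ q * CE) * ∑ x ∈ U, ∫⁻ z in ball x (ρ x), TH h v t (t + ε) z := by
        rw [← Finset.mul_sum, ← mul_assoc, ← ENNReal.ofReal_mul (by positivity)]
    _ = ENNReal.ofReal (CF ^ q * CE) * ∫⁻ z in ⋃ x ∈ U, ball x (ρ x), TH h v t (t + ε) z := by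
        rw [lintegral_biUnion_finset]
        · rw [hUu]
          exact hdisj.mono fun x => ball_subset_closedBall
        · exact fun x _ => measurableSet_ball
    _ ≤ _ := by
        gcongr
        exact Measure.restrict_le_self

open scoped ENNReal Topology

lemma TH_meas {n : ℕ} (h v : EE n → ℝ) (hh : ContDiff ℝ 1 h) (hv : Measurable v) (t t' : ℝ) :
    Measurable (TH h v t t') := by
  unfold TH
  apply Measurable.indicator
  · apply ENNReal.measurable_ofReal.comp
    apply Measurable.mul
    · exact (hh.continuous_fderiv one_ne_zero).norm.measurable
    · exact Real.measurable_exp.comp (hv.const_mul _)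
  · exact ((isOpen_lt continuous_const hh.continuous.abs).inter
      (isOpen_lt hh.continuous.abs continuous_const)).measurableSet

lemma TH_mono {n : ℕ} (h v : EE n → ℝ) (t s s' : ℝ) (hs : s ≤ s') (z : EE n) :
    TH h v t s z ≤ TH h v t s' z := by
  unfold TH
  apply indicator_le_indicator_of_subset
  · intro w hw; exact ⟨hw.1, lt_of_lt_of_le hw.2 hs⟩
  · intro _; exact zero_le

lemma TH_add {n : ℕ} (h v : EE n → ℝ) (t s s' : ℝ) (hts : t ≤ s) (hs : s ≤ s') (z : EE n) :
    TH h v t s z + TH h v s s' z ≤ TH h v t s' z := by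
  by_cases h1 : |h z| < s
  · have : TH h v s s' z = 0 := by
      unfold TH; apply indicator_of_notMem
      intro hw; exact absurd hw.1 (not_lt.2 h1.le)
    rw [this, add_zero]; exact TH_mono h v t s s' hs z
  · have : TH h v t s z = 0 := by
      unfold TH; apply indicator_of_notMem
      intro hw; exact h1 hw.2
    rw [this, zero_add]
    unfold TH
    apply indicator_le_indicator_of_subset
    · intro w hw; exact ⟨lt_of_le_of_lt hts hw.1, hw.2⟩
    · intro _; exact zero_le

lemma weak_band {n : ℕ} (h v : EE n → ℝ) (hh : ContDiff ℝ 1 h) (hv : Measurable v)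
    (c CW : ℝ≥0∞) (hc : c ≠ ∞) (t1 t2 : ℝ) (h12 : t1 < t2)
    (hstep : ∀ t, t1 ≤ t → t < t2 → ∀ᶠ ε in 𝓝[>] (0:ℝ), ENNReal.ofReal ε * c ≤
      CW * ∫⁻ z, TH h v t (t + ε) z) :
    ENNReal.ofReal (t2 - t1) * c ≤ CW * ∫⁻ z, TH h v t1 t2 z := by
  set S : Set ℝ := {s | s ∈ Icc t1 t2 ∧ ENNReal.ofReal (s - t1) * c ≤ CW * ∫⁻ z, TH h v t1 s z} with hS
  have h1S : t1 ∈ S := ⟨⟨le_rfl, h12.le⟩, by simp⟩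
  have hbdd : BddAbove S := ⟨t2, fun s hs => hs.1.2⟩
  set σ := sSup S with hσ
  have hσ1 : t1 ≤ σ := le_csSup hbdd h1S
  have hσ2 : σ ≤ t2 := csSup_le ⟨t1, h1S⟩ fun s hs => hs.1.2
  have hσS : σ ∈ S := by
    refine ⟨⟨hσ1, hσ2⟩, ?_⟩
    obtain ⟨u, hu, hlim, huS⟩ := exists_seq_tendsto_sSup ⟨t1, h1S⟩ hbdd
    have hl : Filter.Tendsto (fun m => ENNReal.ofReal (u m - t1) * c) Filter.atTop
        (𝓝 (ENNReal.ofReal (σ - t1) * c)) := by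
      apply ENNReal.Tendsto.mul_const _ (Or.inr hc)
      exact ENNReal.tendsto_ofReal (hlim.sub_const _)
    refine le_of_tendsto hl (Filter.Eventually.of_forall fun m => ?_)
    refine (huS m).2.trans ?_
    gcongr with z
    exact TH_mono h v t1 _ _ (le_csSup hbdd (huS m)) z
  rcases hσ2.eq_or_lt with he | hlt
  · rw [← he]; exact hσS.2
  · exfalso
    have h3 : Ioo (0:ℝ) (t2 - σ) ∈ 𝓝[>] (0:ℝ) := Ioo_mem_nhdsGT (by linarith)
    obtain ⟨ε, hε, hε2⟩ := ((hstep σ hσ1 hlt).and h3).exists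
    have : σ + ε ∈ S := by
      refine ⟨⟨by linarith [hε2.1], by linarith [hε2.2]⟩, ?_⟩
      calc ENNReal.ofReal (σ + ε - t1) * c = ENNReal.ofReal (σ - t1) * c + ENNReal.ofReal ε * c := by
            rw [← add_mul, ← ENNReal.ofReal_add (by linarith) hε2.1.le]; congr 2; ring
        _ ≤ CW * (∫⁻ z, TH h v t1 σ z) + CW * ∫⁻ z, TH h v σ (σ + ε) z := add_le_add hσS.2 hε
        _ = CW * ∫⁻ z, (TH h v t1 σ z + TH h v σ (σ + ε) z) := by
            rw [← mul_add, lintegral_add_left (TH_meas h v hh hv _ _)]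
        _ ≤ _ := by
            gcongr with z
            exact TH_add h v t1 σ (σ+ε) hσ1 (by linarith [hε2.1]) z
    linarith [le_csSup hbdd this, hε2.1]

lemma strong_of_weak {n : ℕ} (hn : 2 ≤ n) (h v : EE n → ℝ) (hh : ContDiff ℝ 1 h)
    (hv : Measurable v) (CW : ℝ≥0∞)
    (hw : ∀ t1 t2, 0 < t1 → t1 < t2 → ENNReal.ofReal (t2 - t1) *
      (∫⁻ z in {z | t2 ≤ |h z|}, ENNReal.ofReal (Real.exp (n * v z))) ^ (((n:ℝ) - 1) / n) ≤
      CW * ∫⁻ z, TH h v t1 t2 z) :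
    ∫⁻ z, ENNReal.ofReal (|h z| ^ ((n:ℝ) / ((n:ℝ) - 1)) * Real.exp (n * v z)) ≤
      (4 * CW * ∫⁻ z, ENNReal.ofReal (‖fderiv ℝ h z‖ * Real.exp (((n:ℝ) - 1) * v z))) ^
        ((n:ℝ) / ((n:ℝ) - 1)) := by
  have hn2 : (2:ℝ) ≤ n := by exact_mod_cast hn
  have hn0 : (0:ℝ) < n := by linarith
  have hn1 : (0:ℝ) < (n:ℝ) - 1 := by linarith
  set p : ℝ := (n:ℝ) / ((n:ℝ) - 1) with hp
  have hp0 : 0 < p := by positivity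
  have hp1 : 1 ≤ p := by rw [hp, le_div_iff₀ hn1]; linarith
  have hqp : (((n:ℝ) - 1) / n) * p = 1 := by rw [hp]; field_simp
  have hmexp : Measurable fun z => ENNReal.ofReal (Real.exp (n * v z)) :=
    ENNReal.measurable_ofReal.comp (Real.measurable_exp.comp (hv.const_mul _))
  have hms : ∀ s : ℝ, MeasurableSet {z | s ≤ |h z|} := fun s =>
    (isClosed_le continuous_const hh.continuous.abs).measurableSet
  set D : ℤ → ℝ≥0∞ := fun k => ∫⁻ z, TH h v ((2:ℝ) ^ (k-1)) ((2:ℝ) ^ k) z with hD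
  have hk : ∀ k : ℤ, ENNReal.ofReal (((2:ℝ) ^ (k+1)) ^ p) *
      ∫⁻ z in {z | (2:ℝ) ^ k ≤ |h z|}, ENNReal.ofReal (Real.exp (n * v z)) ≤ (4 * CW * D k) ^ p := by
    intro k
    have := hw ((2:ℝ) ^ (k-1)) ((2:ℝ) ^ k) (by positivity) (zpow_lt_zpow_right₀ (by norm_num) (by omega))
    have e : (2:ℝ) ^ k - 2 ^ (k-1) = 2 ^ (k-1) := by
      have : (2:ℝ) ^ k = 2 ^ (k-1) * 2 := by rw [← zpow_add_one₀ (by norm_num)]; simp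
      rw [this]; ring
    rw [e] at this
    have e2 : (2:ℝ) ^ (k+1) = 4 * 2 ^ (k-1) := by
      have : (2:ℝ) ^ (k+1) = 2 ^ (k-1) * 2 ^ (2:ℤ) := by
        rw [← zpow_add₀ (by norm_num)]; congr 1; ring
      rw [this]; norm_num; ring
    calc _ = (4 * (ENNReal.ofReal ((2:ℝ) ^ (k-1)) *
          (∫⁻ z in {z | (2:ℝ) ^ k ≤ |h z|}, ENNReal.ofReal (Real.exp (n * v z))) ^ (((n:ℝ) - 1) / n))) ^ p := by
          rw [← mul_assoc, ENNReal.mul_rpow_of_nonneg _ _ hp0.le, ← ENNReal.rpow_mul, hqp, ENNReal.rpow_one,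
            e2, ← ENNReal.ofReal_rpow_of_nonneg (by positivity) hp0.le, ENNReal.ofReal_mul (by norm_num)]
          norm_num
      _ ≤ (4 * (CW * D k)) ^ p := by gcongr
      _ = _ := by rw [mul_assoc]
  have hsumD : ∑' k, D k ≤ ∫⁻ z, ENNReal.ofReal (‖fderiv ℝ h z‖ * Real.exp (((n:ℝ) - 1) * v z)) := by
    rw [← lintegral_tsum (fun k => (TH_meas h v hh hv _ _).aemeasurable)]
    apply lintegral_mono
    intro z
    simp only [TH]
    by_cases hz : ∃ k : ℤ, (2:ℝ) ^ (k-1) < |h z| ∧ |h z| < 2 ^ k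
    · obtain ⟨k, hk1, hk2⟩ := hz
      rw [tsum_eq_single k]
      · exact indicator_le_self _ _ _
      · intro j hj
        apply indicator_of_notMem
        rintro ⟨h1, h2⟩
        have a1 : (2:ℝ) ^ (k-1) < 2 ^ j := hk1.trans h2
        have a2 : (2:ℝ) ^ (j-1) < 2 ^ k := h1.trans hk2
        rw [zpow_lt_zpow_iff_right₀ (by norm_num)] at a1 a2
        omega
    · push Not at hz
      have : ∀ k : ℤ, ({z | (2:ℝ) ^ (k-1) < |h z| ∧ |h z| < 2 ^ k}.indicator
          (fun z => ENNReal.ofReal (‖fderiv ℝ h z‖ * Real.exp (((n:ℝ) - 1) * v z)))) z = 0 := by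
        intro k
        apply indicator_of_notMem
        rintro ⟨h1, h2⟩
        exact absurd h2 (not_lt.2 (hz k h1))
      rw [ENNReal.tsum_eq_zero.2 this]; exact zero_le
  calc ∫⁻ z, ENNReal.ofReal (|h z| ^ p * Real.exp (n * v z))
      ≤ ∫⁻ z, ∑' k : ℤ, ENNReal.ofReal (((2:ℝ) ^ (k+1)) ^ p) *
        {z | (2:ℝ) ^ k ≤ |h z|}.indicator (fun z => ENNReal.ofReal (Real.exp (n * v z))) z := by
        apply lintegral_mono
        intro z
        simp only
        by_cases hz : h z = 0
        · rw [hz, abs_zero, Real.zero_rpow hp0.ne']; simp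
        · obtain ⟨k, hk1, hk2⟩ := exists_mem_Ico_zpow (abs_pos.2 hz) (one_lt_two : (1:ℝ) < 2)
          refine le_trans ?_ (ENNReal.le_tsum k)
          rw [indicator_of_mem (by exact hk1), ENNReal.ofReal_mul (by positivity)]
          gcongr
    _ = ∑' k : ℤ, ENNReal.ofReal (((2:ℝ) ^ (k+1)) ^ p) *
          ∫⁻ z in {z | (2:ℝ) ^ k ≤ |h z|}, ENNReal.ofReal (Real.exp (n * v z)) := by
        rw [lintegral_tsum (fun k => ((hmexp.indicator (hms _)).const_mul _).aemeasurable)]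
        congr 1; ext k
        rw [lintegral_const_mul _ (hmexp.indicator (hms _)), lintegral_indicator (hms _)]
    _ ≤ ∑' k : ℤ, (4 * CW * D k) ^ p := ENNReal.tsum_le_tsum hk
    _ ≤ (∑' k : ℤ, 4 * CW * D k) ^ p := tsum_rpow_le _ _ hp1
    _ = (4 * CW * ∑' k : ℤ, D k) ^ p := by rw [ENNReal.tsum_mul_left]
    _ ≤ _ := by gcongr

lemma sobolev_abs {n : ℕ} (hn : 2 ≤ n) (h v : EE n → ℝ) (hh : ContDiff ℝ 1 h)
    (hsupp : HasCompactSupport h) (hv : Measurable v) (k : EE n → ℝ → ℝ) (CF CE : ℝ)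
    (hCF : 0 < CF) (hCE : 0 < CE)
    (hU : ∀ x r, 0 < r → ∫⁻ z in ball x (5 * r), ENNReal.ofReal (Real.exp (n * v z)) ≤
      ENNReal.ofReal (CF * (r ^ n * Real.exp (n * k x r))))
    (hloc : ∀ x r t ε, 0 < r → 0 < ε →
      ENNReal.ofReal ((2 ^ (n+2))⁻¹) * volume (ball x r) ≤ volume (ball x r ∩ {z | t + ε ≤ |h z|}) →
      ENNReal.ofReal ((2 ^ (n+2))⁻¹) * volume (ball x r) ≤ volume (ball x r ∩ {z | |h z| ≤ t}) →
      ENNReal.ofReal (ε * r ^ (n - 1) * Real.exp (((n:ℝ) - 1) * k x r)) ≤ ENNReal.ofReal CE *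
        ∫⁻ z in ball x r, TH h v t (t + ε) z) :
    ∫⁻ z, ENNReal.ofReal (|h z| ^ ((n:ℝ) / ((n:ℝ) - 1)) * Real.exp (n * v z)) ≤
      (4 * ENNReal.ofReal (CF ^ (((n:ℝ) - 1) / n) * CE) *
        ∫⁻ z, ENNReal.ofReal (‖fderiv ℝ h z‖ * Real.exp (((n:ℝ) - 1) * v z))) ^
        ((n:ℝ) / ((n:ℝ) - 1)) := by
  have hn2 : (2:ℝ) ≤ n := by exact_mod_cast hn
  have hn0 : (0:ℝ) < n := by linarith
  have hn1 : (0:ℝ) < (n:ℝ) - 1 := by linarith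
  apply strong_of_weak hn h v hh hv
  intro t1 t2 h1 h12
  apply weak_band h v hh hv _ _ _ _ _ h12
  · intro t ht1 ht2
    exact weak_step hn h v hh hsupp hv k CF CE hCF hCE hU hloc t t2 (by linarith) ht2
  · apply ENNReal.rpow_ne_top_of_nonneg (by positivity)
    obtain ⟨R, hR⟩ := hsupp.isCompact.isBounded.subset_ball (0 : EE n)
    have hsub : {z | t2 ≤ |h z|} ⊆ ball (0 : EE n) (5 * max R 1) := by
      intro z hz
      have hz' : t2 ≤ |h z| := hz
      have : z ∈ tsupport h := by
        apply subset_tsupport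
        intro h0
        rw [h0] at hz'; simp at hz'; linarith
      refine ball_subset_ball ?_ (hR this)
      have := le_max_left R 1
      have := le_max_right R 1
      linarith
    refine ne_top_of_le_ne_top ENNReal.ofReal_ne_top
      ((lintegral_mono_set hsub).trans (hU 0 (max R 1) (by positivity)))

open scoped ENNReal Topology

lemma LL_nonneg {n : ℕ} (x₀ : EE n) (r : ℝ) (hr : 0 < r) (x : EE n) (hx : x ∈ ball x₀ (5 * r)) (y : EE n) :
    0 ≤ LL x₀ r x y := by
  unfold LL
  by_cases h0 : ‖x - y‖ = 0
  · rw [h0]; simp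
  · have hp : 0 < ‖x - y‖ := lt_of_le_of_ne (norm_nonneg _) (Ne.symm h0)
    apply Real.log_nonneg
    rw [le_div_iff₀ hp]
    have h1 : ‖x - y‖ ≤ ‖x - x₀‖ + ‖x₀ - y‖ := norm_sub_le_norm_sub_add_norm_sub _ _ _
    rw [mem_ball, dist_eq_norm] at hx
    linarith [norm_nonneg (x₀ - y)]

lemma ae_ne_EE {n : ℕ} (hn : 2 ≤ n) (x : EE n) : ∀ᵐ y : EE n, y ≠ x := by
  haveI : Nontrivial (EE n) := by
    haveI : Nonempty (Fin n) := ⟨⟨0, by omega⟩⟩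
    infer_instance
  exact Measure.ae_ne volume x

lemma k_int {n : ℕ} (hn : 2 ≤ n) (g : EE n → ℝ) (hgm : Measurable g) (hg : Integrable g)
    (hlog : ∀ x : EE n, Integrable (fun y => Real.log (‖y‖ / ‖x - y‖) * g y))
    (x₀ : EE n) (r : ℝ) (hr : 0 < r) :
    Integrable (fun y => Real.log (‖y‖ / (‖x₀ - y‖ + r)) * g y) := by
  set x₁ : EE n := x₀ + EuclideanSpace.single (⟨0, by omega⟩ : Fin n) (2 * r) with hx₁
  have hd : ‖x₁ - x₀‖ = 2 * r := by
    rw [hx₁, add_sub_cancel_left, EuclideanSpace.norm_single, Real.norm_of_nonneg (by positivity)]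
  have hI : Integrable (fun y => Real.log ((‖x₀ - y‖ + r) / ‖x₀ - y‖) * g y) := by
    have hbd := (((hlog x₀).sub (hlog x₁)).norm).add ((hg.norm).const_mul (Real.log 2))
    refine hbd.mono' (by fun_prop) ?_
    filter_upwards [ae_ne_EE hn 0, ae_ne_EE hn x₀, ae_ne_EE hn x₁] with y h1 h2 h3
    have p1 : 0 < ‖y‖ := norm_pos_iff.2 h1
    have p2 : 0 < ‖x₀ - y‖ := norm_pos_iff.2 (sub_ne_zero.2 (Ne.symm h2))
    have p3 : 0 < ‖x₁ - y‖ := norm_pos_iff.2 (sub_ne_zero.2 (Ne.symm h3))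
    simp only [Pi.add_apply, Pi.sub_apply]
    rw [← sub_mul, norm_mul, norm_mul, ← add_mul]
    gcongr
    rw [Real.log_div p1.ne' p2.ne', Real.log_div p1.ne' p3.ne', Real.log_div (by positivity) p2.ne',
      Real.norm_eq_abs, Real.norm_eq_abs]
    have hmono : Real.log ‖x₀ - y‖ ≤ Real.log (‖x₀ - y‖ + r) := Real.log_le_log p2 (by linarith)
    rw [abs_of_nonneg (by linarith)]
    have tri : ‖x₁ - x₀‖ ≤ ‖x₁ - y‖ + ‖x₀ - y‖ := by
      have := norm_sub_le_norm_sub_add_norm_sub x₁ y x₀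
      rwa [norm_sub_rev y x₀] at this
    rcases le_or_gt r ‖x₀ - y‖ with hc | hc
    · have : Real.log (‖x₀ - y‖ + r) ≤ Real.log (2 * ‖x₀ - y‖) :=
        Real.log_le_log (by positivity) (by linarith)
      rw [Real.log_mul (by norm_num) p2.ne'] at this
      have := abs_nonneg (Real.log ‖y‖ - Real.log ‖x₀ - y‖ - (Real.log ‖y‖ - Real.log ‖x₁ - y‖))
      linarith
    · have : Real.log (‖x₀ - y‖ + r) ≤ Real.log (2 * ‖x₁ - y‖) :=
        Real.log_le_log (by positivity) (by linarith)
      rw [Real.log_mul (by norm_num) p3.ne'] at this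
      have := le_abs_self (Real.log ‖y‖ - Real.log ‖x₀ - y‖ - (Real.log ‖y‖ - Real.log ‖x₁ - y‖))
      linarith
  refine ((hlog x₀).sub hI).congr ?_
  filter_upwards [ae_ne_EE hn 0, ae_ne_EE hn x₀] with y h1 h2
  have p1 : 0 < ‖y‖ := norm_pos_iff.2 h1
  have p2 : 0 < ‖x₀ - y‖ := norm_pos_iff.2 (sub_ne_zero.2 (Ne.symm h2))
  simp only [Pi.sub_apply]
  rw [Real.log_div p1.ne' p2.ne', Real.log_div (by positivity) p2.ne', Real.log_div p1.ne' (by positivity)]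
  ring

lemma pot_split {n : ℕ} (hn : 2 ≤ n) (g : EE n → ℝ) (hgm : Measurable g) (hg : Integrable g)
    (hlog : ∀ x : EE n, Integrable (fun y => Real.log (‖y‖ / ‖x - y‖) * g y))
    (x₀ : EE n) (r : ℝ) (hr : 0 < r) (x : EE n) (hx : x ∈ ball x₀ (5 * r)) :
    Integrable (fun y => LL x₀ r x y * max (g y) 0) ∧
    Integrable (fun y => LL x₀ r x y * max (- g y) 0) ∧
    ∫ y, Real.log (‖y‖ / ‖x - y‖) * g y = (∫ y, Real.log (‖y‖ / (‖x₀ - y‖ + r)) * g y)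
      + (∫ y, LL x₀ r x y * max (g y) 0) - (∫ y, LL x₀ r x y * max (- g y) 0)
      - Real.log 5 * ((∫ y, max (g y) 0) - ∫ y, max (- g y) 0) := by
  have hk := k_int hn g hgm hg hlog x₀ r hr
  have hae : ∀ᵐ y : EE n, Real.log (‖y‖ / ‖x - y‖) * g y - Real.log (‖y‖ / (‖x₀ - y‖ + r)) * g y
      + Real.log 5 * g y = LL x₀ r x y * g y := by
    filter_upwards [ae_ne_EE hn 0, ae_ne_EE hn x] with y h1 h2
    have p1 : 0 < ‖y‖ := norm_pos_iff.2 h1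
    have p2 : 0 < ‖x - y‖ := norm_pos_iff.2 (sub_ne_zero.2 (Ne.symm h2))
    unfold LL
    rw [Real.log_div p1.ne' p2.ne', Real.log_div (by positivity) p2.ne',
      Real.log_div p1.ne' (by positivity), Real.log_mul (by norm_num) (by positivity)]
    ring
  have hLL : Integrable (fun y => LL x₀ r x y * g y) :=
    (((hlog x).sub hk).add (hg.const_mul _)).congr hae
  have hP : Integrable (fun y => LL x₀ r x y * max (g y) 0) := by
    refine hLL.pos_part.congr (Filter.Eventually.of_forall fun y => ?_)
    simp only
    rw [mul_max_of_nonneg _ _ (LL_nonneg x₀ r hr x hx y), mul_zero]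
  have hN : Integrable (fun y => LL x₀ r x y * max (- g y) 0) := by
    refine hLL.neg_part.congr (Filter.Eventually.of_forall fun y => ?_)
    simp only
    rw [mul_max_of_nonneg _ _ (LL_nonneg x₀ r hr x hx y), mul_zero, mul_neg]
  refine ⟨hP, hN, ?_⟩
  have e1 : ∫ y, LL x₀ r x y * g y = (∫ y, LL x₀ r x y * max (g y) 0) - ∫ y, LL x₀ r x y * max (- g y) 0 := by
    rw [← integral_sub hP hN]
    congr 1; ext y
    rw [← mul_sub]; congr 1
    rcases le_total 0 (g y) with h | h
    · rw [max_eq_left h, max_eq_right (by linarith)]; ring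
    · rw [max_eq_right h, max_eq_left (by linarith)]; ring
  have e2 : ∫ y, g y = (∫ y, max (g y) 0) - ∫ y, max (- g y) 0 := by
    rw [← integral_sub hg.pos_part hg.neg_part]
    congr 1; ext y
    rcases le_total 0 (g y) with h | h
    · rw [max_eq_left h, max_eq_right (by linarith)]; ring
    · rw [max_eq_right h, max_eq_left (by linarith)]; ring
  have e3 := integral_congr_ae hae
  have e4 := integral_add ((hlog x).sub hk) (hg.const_mul (Real.log 5))
  simp only [Pi.sub_apply] at e4
  rw [e4, integral_sub (hlog x) hk, integral_const_mul] at e3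
  rw [← e2]
  linarith

lemma jensen {n : ℕ} (P L : EE n → ℝ) (hP : Integrable P) (hP0 : ∀ y, 0 ≤ P y)
    (hLP : Integrable (fun y => L y * P y)) (a' : ℝ) (ha : (∫ y, P y) ≤ a') (ha' : 0 < a') :
    ENNReal.ofReal (a' * Real.exp (n * ∫ y, L y * P y)) ≤
      (∫⁻ y, ENNReal.ofReal (Real.exp (n * a' * L y)) * ENNReal.ofReal (P y)) + ENNReal.ofReal a' := by
  set m := ∫ y, L y * P y with hm
  set a := ∫ y, P y with hadef
  have ha0 : 0 ≤ a := integral_nonneg hP0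
  set E := Real.exp (n * m)
  have hE : 0 < E := Real.exp_pos _
  set F : EE n → ℝ := fun y => E * (1 - n * m) * P y + E * (n * a') * (L y * P y) with hF
  have hFi : Integrable F := (hP.const_mul _).add (hLP.const_mul _)
  have hFint : ∫ y, F y = E * (1 - n * m) * a + E * (n * a') * m := by
    rw [hF, integral_add (hP.const_mul _) (hLP.const_mul _), integral_const_mul, integral_const_mul]
  have hFle : ∀ y, F y ≤ Real.exp (n * a' * L y) * P y := by
    intro y
    have h1 : n * a' * L y - n * m + 1 ≤ Real.exp (n * a' * L y - n * m) := Real.add_one_le_exp _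
    have h2 : Real.exp (n * a' * L y) = E * Real.exp (n * a' * L y - n * m) := by
      rw [← Real.exp_add]; congr 1; ring
    have : F y = E * (n * a' * L y - n * m + 1) * P y := by rw [hF]; ring
    rw [this, h2]
    have := hP0 y
    gcongr
  have h3 : E * (1 - n * m) ≤ 1 := by
    have h1 : -(n * m) + 1 ≤ Real.exp (-(n * m)) := Real.add_one_le_exp _
    have h2 : E * Real.exp (-(n * m)) = 1 := by rw [← Real.exp_add]; simp
    nlinarith
  have h4 : a' * E ≤ (∫ y, F y) + a' := by
    rw [hFint]; nlinarith
  calc _ ≤ ENNReal.ofReal ((∫ y, F y) + a') := ENNReal.ofReal_le_ofReal h4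
    _ ≤ ENNReal.ofReal (∫ y, F y) + ENNReal.ofReal a' := ENNReal.ofReal_add_le
    _ ≤ _ := by
      gcongr
      have h5 : (∫ y, F y) ≤ ∫ y, max (F y) 0 := integral_mono hFi hFi.pos_part fun y => le_max_left _ _
      refine (ENNReal.ofReal_le_ofReal h5).trans ?_
      rw [ofReal_integral_eq_lintegral_ofReal hFi.pos_part
        (Filter.Eventually.of_forall fun y => le_max_right _ _)]
      apply lintegral_mono
      intro y
      simp only
      rw [← ENNReal.ofReal_mul (Real.exp_pos _).le]
      apply ENNReal.ofReal_le_ofReal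
      exact max_le (hFle y) (mul_nonneg (Real.exp_pos _).le (hP0 y))

open scoped ENNReal Topology

lemma exp_LL_le {n : ℕ} (hn : 2 ≤ n) (a' : ℝ) (ha' : 0 < a') (ha1 : a' < 1) (x₀ : EE n) (r : ℝ)
    (hr : 0 < r) (x : EE n) (hx : x ∈ ball x₀ (5 * r)) (y : EE n) :
    Real.exp (n * a' * LL x₀ r x y) ≤ 12 ^ n * (1 + (5 * r / ‖x - y‖) ^ (n * a')) := by
  have hn2 : (2:ℝ) ≤ n := by exact_mod_cast hn
  have hp0 : 0 < n * a' := by positivity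
  have hpn : n * a' ≤ n := by nlinarith
  have h12 : (1:ℝ) ≤ 12 ^ n := one_le_pow₀ (by norm_num)
  by_cases h0 : ‖x - y‖ = 0
  · unfold LL
    rw [h0, div_zero, div_zero, Real.log_zero, mul_zero, Real.exp_zero, Real.zero_rpow hp0.ne']
    linarith
  have hp : 0 < ‖x - y‖ := lt_of_le_of_ne (norm_nonneg _) (Ne.symm h0)
  have h1 : ‖x₀ - y‖ ≤ ‖x - x₀‖ + ‖x - y‖ := by
    have := norm_sub_le_norm_sub_add_norm_sub x₀ x y
    rwa [norm_sub_rev x₀ x] at this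
  rw [mem_ball, dist_eq_norm] at hx
  set q := 5 * r / ‖x - y‖ with hq
  have hq0 : 0 < q := by positivity
  have e1 : Real.exp (n * a' * LL x₀ r x y) = (5 * (‖x₀ - y‖ + r) / ‖x - y‖) ^ (n * a') := by
    unfold LL
    rw [Real.rpow_def_of_pos (by positivity), mul_comm]
  have e2 : 5 * (‖x₀ - y‖ + r) / ‖x - y‖ ≤ 12 * max 1 q := by
    have : 5 * (‖x₀ - y‖ + r) / ‖x - y‖ ≤ 5 + 6 * q := by
      rw [hq, div_le_iff₀ hp, add_mul, mul_assoc 6, div_mul_cancel₀ _ h0]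
      linarith
    linarith [le_max_left 1 q, le_max_right 1 q]
  rw [e1]
  calc _ ≤ (12 * max 1 q) ^ (n * a') := by gcongr
    _ = 12 ^ (n * a') * (max 1 q) ^ (n * a') := Real.mul_rpow (by norm_num) (by positivity)
    _ ≤ 12 ^ n * (1 + q ^ (n * a')) := by
        gcongr
        · rw [← Real.rpow_natCast]
          exact Real.rpow_le_rpow_of_exponent_le (by norm_num) hpn
        · rcases le_total 1 q with h | h
          · rw [max_eq_right h]; linarith
          · rw [max_eq_left h, Real.one_rpow]
            have : 0 ≤ q ^ (n * a') := by positivity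
            linarith

lemma upper (n : ℕ) (hn : 2 ≤ n) (a b : ℝ) (ha0 : 0 ≤ a) (ha : a < 1) (hb0 : 0 ≤ b) :
    ∃ CF : ℝ, 0 < CF ∧ ∀ (P : EE n → ℝ) (v : EE n → ℝ) (k : ℝ) (x₀ : EE n) (r : ℝ), 0 < r →
      Measurable P → Integrable P → (∀ y, 0 ≤ P y) → (∫ y, P y) = a →
      (∀ x ∈ ball x₀ (5 * r), Integrable (fun y => LL x₀ r x y * P y) ∧
        v x ≤ k + b * Real.log 5 + ∫ y, LL x₀ r x y * P y) →
      ∫⁻ z in ball x₀ (5 * r), ENNReal.ofReal (Real.exp (n * v z)) ≤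
        ENNReal.ofReal (CF * (r ^ n * Real.exp (n * k))) := by
  have hn2 : (2:ℝ) ≤ n := by exact_mod_cast hn
  set a' : ℝ := (1 + a) / 2 with ha'
  have ha'0 : 0 < a' := by positivity
  have ha'1 : a' < 1 := by rw [ha']; linarith
  have haa' : a ≤ a' := by rw [ha']; linarith
  obtain ⟨K, hK0, hK⟩ := kernel_bound n hn (n * a') (by positivity) (by nlinarith)
  set V : ℝ := (volume (ball (0 : EE n) 1)).toReal with hV
  have hV' : volume (ball (0 : EE n) 1) = ENNReal.ofReal V := by
    rw [hV, ENNReal.ofReal_toReal measure_ball_lt_top.ne]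
  have hV0 : 0 < V := ENNReal.toReal_pos (measure_ball_pos _ _ one_pos).ne' measure_ball_lt_top.ne
  set M : ℝ := 12 ^ n * (V + K) with hM
  have hM0 : 0 < M := by positivity
  refine ⟨Real.exp (n * (b * Real.log 5)) / a' * (M * a + a' * V) * 5 ^ n, by positivity, ?_⟩
  intro P v k x₀ r hr hPm hP hP0 hPa hv
  set R := 5 * r with hR
  have hR0 : 0 < R := by positivity
  have hvolR : volume (ball x₀ R) = ENNReal.ofReal (V * R ^ n) := by
    rw [vol_ball x₀ hR0, hV', ← ENNReal.ofReal_mul (by positivity), mul_comm]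
  set c1 : ℝ := Real.exp (n * (k + b * Real.log 5)) / a' with hc1
  have hc10 : 0 < c1 := by positivity
  have hmeas : Measurable (Function.uncurry fun x y : EE n =>
      ENNReal.ofReal (Real.exp (n * a' * LL x₀ r x y)) * ENNReal.ofReal (P y)) := by
    unfold LL Function.uncurry
    fun_prop
  have hy : ∀ y, ∫⁻ x in ball x₀ R, ENNReal.ofReal (Real.exp (n * a' * LL x₀ r x y)) ≤
      ENNReal.ofReal (M * R ^ n) := by
    intro y
    calc _ ≤ ∫⁻ x in ball x₀ R, ENNReal.ofReal (12 ^ n) * (1 + ENNReal.ofReal ((R / ‖x - y‖) ^ (n * a'))) := by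
          apply setLIntegral_mono' measurableSet_ball
          intro x hx
          rw [← ENNReal.ofReal_one, ← ENNReal.ofReal_add (by norm_num) (by positivity),
            ← ENNReal.ofReal_mul (by positivity)]
          exact ENNReal.ofReal_le_ofReal (exp_LL_le hn a' ha'0 ha'1 x₀ r hr x hx y)
      _ = ENNReal.ofReal (12 ^ n) * (ENNReal.ofReal (V * R ^ n) +
          ∫⁻ x in ball x₀ R, ENNReal.ofReal ((R / ‖x - y‖) ^ (n * a'))) := by
          rw [lintegral_const_mul _ (by fun_prop), lintegral_add_left measurable_const]
          rw [lintegral_const, one_mul, Measure.restrict_apply_univ, hvolR]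
      _ ≤ ENNReal.ofReal (12 ^ n) * (ENNReal.ofReal (V * R ^ n) + ENNReal.ofReal (K * R ^ n)) := by
          gcongr
          exact hK x₀ y R hR0
      _ = _ := by
          rw [← ENNReal.ofReal_add (by positivity) (by positivity), ← ENNReal.ofReal_mul (by positivity)]
          congr 1; rw [hM]; ring
  calc _ ≤ ∫⁻ x in ball x₀ R, ENNReal.ofReal c1 *
        ((∫⁻ y, ENNReal.ofReal (Real.exp (n * a' * LL x₀ r x y)) * ENNReal.ofReal (P y)) +
          ENNReal.ofReal a') := by
        apply setLIntegral_mono' measurableSet_ball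
        intro x hx
        obtain ⟨h1, h2⟩ := hv x hx
        refine le_trans ?_ (mul_le_mul_right (jensen P (LL x₀ r x) hP hP0 h1 a' (hPa.trans_le haa') ha'0) _)
        rw [← ENNReal.ofReal_mul hc10.le]
        apply ENNReal.ofReal_le_ofReal
        rw [hc1, ← mul_assoc, div_mul_cancel₀ _ ha'0.ne', ← Real.exp_add]
        apply Real.exp_le_exp.2
        rw [← mul_add]
        gcongr
    _ = ENNReal.ofReal c1 * ((∫⁻ y, (∫⁻ x in ball x₀ R, ENNReal.ofReal (Real.exp (n * a' * LL x₀ r x y))) *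
          ENNReal.ofReal (P y)) + ENNReal.ofReal a' * ENNReal.ofReal (V * R ^ n)) := by
        have hm1 : Measurable fun x => ∫⁻ y, ENNReal.ofReal (Real.exp (n * a' * LL x₀ r x y)) * ENNReal.ofReal (P y) :=
          hmeas.lintegral_prod_right'
        rw [lintegral_const_mul _ (hm1.add_const _), lintegral_add_left hm1, lintegral_const,
          Measure.restrict_apply_univ, hvolR]
        rw [lintegral_lintegral_swap hmeas.aemeasurable]
        congr 3
        ext y
        rw [lintegral_mul_const]
        unfold LL
        fun_prop
    _ ≤ ENNReal.ofReal c1 * ((∫⁻ y, ENNReal.ofReal (M * R ^ n) *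
          ENNReal.ofReal (P y)) + ENNReal.ofReal a' * ENNReal.ofReal (V * R ^ n)) := by
        gcongr with y
        exact hy y
    _ = ENNReal.ofReal c1 * (ENNReal.ofReal (M * R ^ n) * ENNReal.ofReal a +
          ENNReal.ofReal a' * ENNReal.ofReal (V * R ^ n)) := by
        rw [lintegral_const_mul _ (by fun_prop), ← ofReal_integral_eq_lintegral_ofReal hP
          (Filter.Eventually.of_forall hP0), hPa]
    _ = _ := by
        rw [← ENNReal.ofReal_mul (by positivity), ← ENNReal.ofReal_mul (by positivity),
          ← ENNReal.ofReal_add (by positivity) (by positivity), ← ENNReal.ofReal_mul (by positivity)]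
        congr 1
        rw [hc1, hR, mul_pow, mul_add (n:ℝ), Real.exp_add]
        ring

lemma cN_pos (n : ℕ) (hn : 2 ≤ n) : 0 < cN n := by
  unfold cN
  have : 0 < (n:ℝ) / 2 := by
    have : (2:ℝ) ≤ n := by exact_mod_cast hn
    linarith
  have := Real.Gamma_pos_of_pos this
  have := Real.pi_pos
  positivity

lemma main_enn (n : ℕ) (hn : 2 ≤ n) (a b : ℝ) (ha0 : 0 ≤ a) (ha : a < 1) (hb0 : 0 ≤ b) :
    ∃ C : ℝ, 0 < C ∧ ∀ (g : EE n → ℝ) (C₀ : ℝ), Measurable g → Integrable g →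
      (∀ x : EE n, Integrable (fun y => Real.log (‖y‖ / ‖x - y‖) * g y)) →
      (∫ y, max (g y) 0) = a → (∫ y, max (- g y) 0) = b →
      ∀ v : EE n → ℝ, (∀ x, v x = (∫ y, Real.log (‖y‖ / ‖x - y‖) * g y) + C₀) →
      Measurable v ∧
      (∀ R, ∫⁻ z in ball (0 : EE n) R, ENNReal.ofReal (Real.exp (n * v z)) < ∞) ∧
      ∀ h : EE n → ℝ, ContDiff ℝ 1 h → HasCompactSupport h →
      ∫⁻ z, ENNReal.ofReal (|h z| ^ ((n:ℝ) / ((n:ℝ) - 1)) * Real.exp (n * v z)) ≤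
      (ENNReal.ofReal C *
        ∫⁻ z, ENNReal.ofReal (‖fderiv ℝ h z‖ * Real.exp (((n:ℝ) - 1) * v z))) ^
        ((n:ℝ) / ((n:ℝ) - 1)) := by
  obtain ⟨CF, hCF, hup⟩ := upper n hn a b ha0 ha hb0
  have hl5 : 0 ≤ Real.log 5 := Real.log_nonneg (by norm_num)
  obtain ⟨CE, hCE, hlocal⟩ := local_ineq n hn (a * Real.log 5) b ((2 ^ (n+2))⁻¹) (by positivity) hb0 (by positivity)
  refine ⟨4 * (CF ^ (((n:ℝ) - 1) / n) * CE), by positivity, ?_⟩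
  intro g C₀ hgm hg hlog hga hgb v hv
  have hvm : Measurable v := by
    have : StronglyMeasurable fun x : EE n => ∫ y, Real.log (‖y‖ / ‖x - y‖) * g y := by
      apply StronglyMeasurable.integral_prod_right' (f := fun p : EE n × EE n => Real.log (‖p.2‖ / ‖p.1 - p.2‖) * g p.2)
      apply Measurable.stronglyMeasurable
      fun_prop
    have h2 := this.measurable.add_const C₀
    have h3 : v = fun x => (∫ y, Real.log (‖y‖ / ‖x - y‖) * g y) + C₀ := funext hv
    rw [h3]; exact h2
  set k : EE n → ℝ → ℝ := fun x₀ r => (∫ y, Real.log (‖y‖ / (‖x₀ - y‖ + r)) * g y) + C₀ with hk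
  have hU : ∀ x r, 0 < r → ∫⁻ z in ball x (5 * r), ENNReal.ofReal (Real.exp (n * v z)) ≤
      ENNReal.ofReal (CF * (r ^ n * Real.exp (n * k x r))) := by
    intro x₀ r hr
    apply hup (fun y => max (g y) 0) v (k x₀ r) x₀ r hr (by fun_prop) hg.pos_part
      (fun y => le_max_right _ _) hga
    intro x hx
    obtain ⟨h1, h2, h3⟩ := pot_split hn g hgm hg hlog x₀ r hr x hx
    refine ⟨h1, ?_⟩
    rw [hv x, h3, hga, hgb, hk]
    have h4 : 0 ≤ ∫ y, LL x₀ r x y * max (- g y) 0 :=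
      integral_nonneg fun y => mul_nonneg (LL_nonneg x₀ r hr x hx y) (le_max_right _ _)
    simp only
    nlinarith [mul_nonneg ha0 hl5]
  refine ⟨hvm, ?_, ?_⟩
  · intro R
    refine lt_of_le_of_lt ((lintegral_mono_set (ball_subset_ball ?_)).trans (hU 0 (max R 1) (by positivity)))
      ENNReal.ofReal_lt_top
    have := le_max_left R 1
    have := le_max_right R 1
    linarith
  · intro h hh hsupp
    have := sobolev_abs hn h v hh hsupp hvm k CF CE hCF hCE hU ?_
    · rw [ENNReal.ofReal_mul (by norm_num)]
      simpa using this
    · intro x₀ r t ε hr hε hA hB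
      refine hlocal (fun y => max (- g y) 0) v (k x₀ r) x₀ r h t ε hr hε (by fun_prop) hvm hh ?_ ?_ hA hB
      · rw [← ofReal_integral_eq_lintegral_ofReal hg.neg_part
          (Filter.Eventually.of_forall fun y => le_max_right _ _), hgb]
      · intro x hx
        have hx5 : x ∈ ball x₀ (5 * r) := ball_subset_ball (by linarith) hx
        obtain ⟨h1, h2, h3⟩ := pot_split hn g hgm hg hlog x₀ r hr x hx5
        have h4 : 0 ≤ ∫ y, LL x₀ r x y * max (g y) 0 :=
          integral_nonneg fun y => mul_nonneg (LL_nonneg x₀ r hr x hx5 y) (le_max_right _ _)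
        have h5 : k x₀ r - v x ≤ a * Real.log 5 + ∫ y, LL x₀ r x y * max (- g y) 0 := by
          rw [hv x, h3, hga, hgb, hk]
          simp only
          nlinarith [mul_nonneg hb0 hl5]
        refine (ENNReal.ofReal_le_ofReal h5).trans (ENNReal.ofReal_add_le.trans ?_)
        gcongr
        rw [ofReal_integral_eq_lintegral_ofReal h2 (Filter.Eventually.of_forall fun y =>
          mul_nonneg (LL_nonneg x₀ r hr x hx5 y) (le_max_right _ _))]
        apply le_of_eq
        congr 1; ext y
        rw [ENNReal.ofReal_mul (LL_nonneg x₀ r hr x hx5 y)]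

/-- Isoperimetric (p = 1 Sobolev) inequality for the conformal metric
`g = e^{2u}|dx|²` given by a normal logarithmic potential `u + C₀`, with constant
depending only on `n`, `α = ∫ f⁺` and `β = ∫ f⁻`. -/
theorem isoperimetric_of_logPotential
    (n : ℕ) (hn : 2 ≤ n) (α β : ℝ) (hα : α < cN n) :
    ∃ C : ℝ, 0 < C ∧
      ∀ (f : EuclideanSpace ℝ (Fin n) → ℝ) (C₀ : ℝ),
        Continuous f →
        Integrable f →
        (∀ x : EuclideanSpace ℝ (Fin n),
          Integrable (fun y => Real.log (‖y‖ / ‖x - y‖) * f y)) →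
        (∫ y, max (f y) 0) = α →
        (∫ y, max (-f y) 0) = β →
        ∀ h : EuclideanSpace ℝ (Fin n) → ℝ,
          ContDiff ℝ 1 h → HasCompactSupport h →
          (∫ x, |h x| ^ ((n : ℝ) / ((n : ℝ) - 1)) *
              Real.exp ((n : ℝ) * (logPot n f x + C₀))) ^ (((n : ℝ) - 1) / n) ≤
            C * ∫ x, ‖gradient h x‖ *
              Real.exp (((n : ℝ) - 1) * (logPot n f x + C₀)) := by
  have hc := cN_pos n hn
  by_cases hαβ : 0 ≤ α ∧ 0 ≤ β
  swap
  · refine ⟨1, one_pos, ?_⟩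
    intro f C₀ _ _ _ h1 h2
    exfalso
    apply hαβ
    rw [← h1, ← h2]
    exact ⟨integral_nonneg fun y => le_max_right _ _, integral_nonneg fun y => le_max_right _ _⟩
  obtain ⟨hα0, hβ0⟩ := hαβ
  obtain ⟨C, hC0, hC⟩ := main_enn n hn (α / cN n) (β / cN n) (by positivity)
    ((div_lt_one hc).2 hα) (by positivity)
  refine ⟨C, hC0, ?_⟩
  intro f C₀ hfc hfi hlog hfa hfb h hh hsupp
  have hn2 : (2:ℝ) ≤ n := by exact_mod_cast hn
  have hn1 : (0:ℝ) < (n:ℝ) - 1 := by linarith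
  set v : EE n → ℝ := fun x => logPot n f x + C₀ with hv
  have hmaxdiv : ∀ s : ℝ, max (s / cN n) 0 = max s 0 / cN n := fun s => by
    rw [max_div_div_right hc.le s 0 |>.symm]; simp
  obtain ⟨hvm, hfin, hS⟩ := hC (fun y => f y / cN n) C₀ (hfc.measurable.div_const _) (hfi.div_const _)
    (fun x => by
      have := (hlog x).div_const (cN n)
      refine this.congr (Filter.Eventually.of_forall fun y => ?_)
      simp only; ring)
    (by simp only [hmaxdiv]; rw [integral_div, hfa])
    (by simp only [← neg_div, hmaxdiv]; rw [integral_div, hfb])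
    v (fun x => by
      rw [hv]; simp only [logPot]
      rw [← integral_const_mul]
      congr 2; ext y; ring)
  have hSh := hS h hh hsupp
  have hgrad : ∀ x, ‖gradient h x‖ = ‖fderiv ℝ h x‖ := fun x => by
    unfold gradient; exact LinearIsometryEquiv.norm_map _ _
  simp only [hgrad]
  change (∫ x, |h x| ^ ((n : ℝ) / ((n : ℝ) - 1)) * Real.exp ((n : ℝ) * v x)) ^ (((n : ℝ) - 1) / n) ≤
            C * ∫ x, ‖fderiv ℝ h x‖ * Real.exp (((n : ℝ) - 1) * v x)
  have hfd : Continuous (fderiv ℝ h) := hh.continuous_fderiv one_ne_zero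
  have hfds : HasCompactSupport (fderiv ℝ h) := hsupp.fderiv ℝ
  obtain ⟨D, hD⟩ := hfd.bounded_above_of_compact_support hfds
  have hD0 : 0 ≤ D := (norm_nonneg _).trans (hD 0)
  obtain ⟨R, hR⟩ := hfds.isCompact.isBounded.subset_ball (0 : EE n)
  have hTfin : ∫⁻ z, ENNReal.ofReal (‖fderiv ℝ h z‖ * Real.exp (((n:ℝ) - 1) * v z)) < ∞ := by
    calc _ ≤ ∫⁻ z, (ball (0 : EE n) R).indicator (fun z => ENNReal.ofReal D *
          (1 + ENNReal.ofReal (Real.exp (n * v z)))) z := by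
          apply lintegral_mono
          intro z
          simp only
          by_cases hz : z ∈ ball (0 : EE n) R
          · rw [indicator_of_mem hz, ← ENNReal.ofReal_one, ← ENNReal.ofReal_add (by norm_num) (by positivity),
              ← ENNReal.ofReal_mul hD0]
            apply ENNReal.ofReal_le_ofReal
            gcongr
            · exact hD z
            · rcases le_total 0 (v z) with hvz | hvz
              · have : Real.exp (((n:ℝ) - 1) * v z) ≤ Real.exp (n * v z) := by
                  apply Real.exp_le_exp.2; nlinarith
                linarith
              · have : Real.exp (((n:ℝ) - 1) * v z) ≤ 1 := by
                  apply Real.exp_le_one_iff.2; nlinarith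
                linarith [Real.exp_pos (n * v z)]
          · rw [image_eq_zero_of_notMem_tsupport (fun hz' => hz (hR hz'))]
            simp
      _ = ENNReal.ofReal D * (volume (ball (0 : EE n) R) +
          ∫⁻ z in ball (0 : EE n) R, ENNReal.ofReal (Real.exp (n * v z))) := by
          rw [lintegral_indicator measurableSet_ball, lintegral_const_mul _ (by fun_prop),
            lintegral_add_left measurable_const, lintegral_const, one_mul, Measure.restrict_apply_univ]
      _ < ∞ := ENNReal.mul_lt_top ENNReal.ofReal_lt_top
          (ENNReal.add_lt_top.2 ⟨measure_ball_lt_top, hfin R⟩)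
  have hT : ∫ x, ‖fderiv ℝ h x‖ * Real.exp (((n : ℝ) - 1) * v x) =
      (∫⁻ z, ENNReal.ofReal (‖fderiv ℝ h z‖ * Real.exp (((n:ℝ) - 1) * v z))).toReal := by
    apply integral_eq_lintegral_of_nonneg_ae
    · exact Filter.Eventually.of_forall fun z => by positivity
    · apply Measurable.aestronglyMeasurable
      exact hfd.norm.measurable.mul (Real.measurable_exp.comp (hvm.const_mul _))
  have hLs : ∫ x, |h x| ^ ((n : ℝ) / ((n : ℝ) - 1)) * Real.exp ((n : ℝ) * v x) =
      (∫⁻ z, ENNReal.ofReal (|h z| ^ ((n:ℝ) / ((n:ℝ) - 1)) * Real.exp (n * v z))).toReal := by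
    apply integral_eq_lintegral_of_nonneg_ae
    · exact Filter.Eventually.of_forall fun z => by positivity
    · apply Measurable.aestronglyMeasurable
      exact (hh.continuous.abs.measurable.pow_const _).mul (Real.measurable_exp.comp (hvm.const_mul _))
  rw [hT, hLs, ENNReal.toReal_rpow]
  have hqp : ((n:ℝ) / ((n:ℝ) - 1)) * (((n:ℝ) - 1) / n) = 1 := by
    have : (n:ℝ) ≠ 0 := by linarith
    field_simp
  have hfinal := ENNReal.rpow_le_rpow hSh (z := ((n:ℝ) - 1) / n) (by positivity)
  rw [← ENNReal.rpow_mul, hqp, ENNReal.rpow_one] at hfinal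
  have h2 := ENNReal.toReal_mono (ENNReal.mul_ne_top ENNReal.ofReal_ne_top hTfin.ne) hfinal
  rwa [ENNReal.toReal_mul, ENNReal.toReal_ofReal hC0.le] at h2
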